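/- arXiv:2304.06361 — 3 statements merged into one kernel-verified Lean document; each statement's English description precedes it below -/
import Mathlib

section
/- Let f_n : (2^ω)^ω → 2 be continuous functions (where 2 = {0,1} is discrete). Then there exist an infinite set N ⊆ ω and nonempty perfect sets P_k ⊆ 2^ω for k ∈ ω such that the subsequence (f_n)_{n ∈ N} converges pointwise on the product ∏_{k∈ω} P_k. -/
open Filter MeasureTheory Topology

section ProductMeasure

variable {ι α : Type*} [DecidableEq ι] [MeasurableSpace α]

theorem measurable_update_prod (p : ι) :
    Measurable fun z : (ι → α) × α => Function.update z.1 p z.2 := by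
  refine measurable_pi_lambda _ fun i => ?_
  by_cases h : i = p
  · subst h; simpa using measurable_snd
  · simp only [Function.update_of_ne h]
    exact (measurable_pi_apply i).comp measurable_fst

theorem map_update_infinitePi (ν : Measure α) [IsProbabilityMeasure ν] (p : ι) :
    ((Measure.infinitePi fun _ : ι => ν).prod ν).map (fun z => Function.update z.1 p z.2) =
      Measure.infinitePi fun _ : ι => ν := by
  refine Measure.eq_infinitePi _ fun s t ht => ?_
  rw [Measure.map_apply (measurable_update_prod p)
    (MeasurableSet.pi s.countable_toSet fun i _ => ht i)]
  by_cases hp : p ∈ s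
  · have : (fun z : (ι → α) × α => Function.update z.1 p z.2) ⁻¹' Set.pi s t =
        Set.pi (s.erase p : Finset ι) t ×ˢ t p := by
      ext z
      simp only [Set.mem_preimage, Set.mem_pi, Set.mem_prod, Finset.mem_coe, Finset.mem_erase]
      constructor
      · intro h
        exact ⟨fun i hi => by simpa [Function.update_of_ne hi.1] using h i hi.2,
          by simpa using h p hp⟩
      · rintro ⟨h1, h2⟩ i hi
        by_cases hip : i = p
        · subst hip; simpa using h2
        · simpa [Function.update_of_ne hip] using h1 i ⟨hip, hi⟩
    rw [this, Measure.prod_prod, Measure.infinitePi_pi _ fun i _ => ht i,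
      Finset.prod_erase_mul _ _ hp]
  · have : (fun z : (ι → α) × α => Function.update z.1 p z.2) ⁻¹' Set.pi s t =
        Set.pi s t ×ˢ Set.univ := by
      ext z
      simp only [Set.mem_preimage, Set.mem_pi, Set.mem_prod, Finset.mem_coe, Set.mem_univ,
        and_true]
      refine forall₂_congr fun i hi => ?_
      rw [Function.update_of_ne (ne_of_mem_of_not_mem hi hp)]
    rw [this, Measure.prod_prod, Measure.infinitePi_pi _ fun i _ => ht i]
    simp

theorem lintegral_infinitePi_update (ν : Measure α) [IsProbabilityMeasure ν] (p : ι)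
    {h : (ι → α) → ENNReal} (hh : Measurable h) :
    ∫⁻ x, h x ∂(Measure.infinitePi fun _ : ι => ν) =
      ∫⁻ x, ∫⁻ s, h (Function.update x p s) ∂ν ∂(Measure.infinitePi fun _ : ι => ν) := by
  conv_lhs => rw [← map_update_infinitePi ν p]
  rw [lintegral_map hh (measurable_update_prod p), lintegral_prod]
  exact (hh.comp (measurable_update_prod p)).aemeasurable

theorem infinitePi_apply_update (ν : Measure α) [IsProbabilityMeasure ν] (p : ι)
    {E : Set (ι → α)} (hE : MeasurableSet E) :
    (Measure.infinitePi fun _ : ι => ν) E =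
      ∫⁻ x, ν {s | Function.update x p s ∈ E} ∂(Measure.infinitePi fun _ : ι => ν) := by
  conv_lhs => rw [← map_update_infinitePi ν p]
  rw [Measure.map_apply (measurable_update_prod p) hE,
    Measure.prod_apply (measurable_update_prod p hE)]
  rfl

theorem lintegral_sq_le_lintegral_sq {Ω : Type*} [MeasurableSpace Ω] (μ : Measure Ω)
    [IsProbabilityMeasure μ] {g : Ω → ENNReal} (hg : AEMeasurable g μ) :
    (∫⁻ x, g x ∂μ) ^ 2 ≤ ∫⁻ x, g x ^ 2 ∂μ := by
  have h := ENNReal.lintegral_mul_le_Lp_mul_Lq μ Real.HolderConjugate.two_two hg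
    (aemeasurable_const (b := (1 : ENNReal)))
  simp only [Pi.mul_apply, mul_one, ENNReal.one_rpow, lintegral_const, measure_univ] at h
  calc (∫⁻ x, g x ∂μ) ^ 2 ≤ ((∫⁻ x, g x ^ (2 : ℝ) ∂μ) ^ (1 / 2 : ℝ)) ^ 2 := by gcongr
    _ = ∫⁻ x, g x ^ 2 ∂μ := by
      rw [← ENNReal.rpow_natCast, ← ENNReal.rpow_mul]
      norm_num

/-- The configuration `x` with its coordinate at `p` replaced by the one at `q`. -/
def copyCoord (p q : ι) (x : ι → α) : ι → α := Function.update x p (x q)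

theorem measurable_copyCoord (p q : ι) : Measurable (copyCoord (α := α) p q) :=
  (measurable_update_prod p).comp (measurable_id.prodMk (measurable_pi_apply q))

theorem sq_measure_le_measure_inter_copyCoord (ν : Measure α) [IsProbabilityMeasure ν] {p q : ι}
    (hpq : p ≠ q) {E : Set (ι → α)} (hE : MeasurableSet E)
    (hq : ∀ x t, Function.update x q t ∈ E ↔ x ∈ E) :
    (Measure.infinitePi fun _ : ι => ν) E ^ 2 ≤
      (Measure.infinitePi fun _ : ι => ν) (E ∩ copyCoord p q ⁻¹' E) := by
  set μ := Measure.infinitePi fun _ : ι => ν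
  let g : (ι → α) → ENNReal := fun x => ν {s | Function.update x p s ∈ E}
  have hg : Measurable g := measurable_measure_prodMk_left (measurable_update_prod p hE)
  have hgp (x : ι → α) (s : α) : g (Function.update x p s) = g x := by simp [g]
  have key : μ (E ∩ copyCoord p q ⁻¹' E) = ∫⁻ x, g x ^ 2 ∂μ := by
    rw [infinitePi_apply_update ν q (hE.inter (measurable_copyCoord p q hE))]
    have h1 (x : ι → α) : ν {s | Function.update x q s ∈ E ∩ copyCoord p q ⁻¹' E} =
        E.indicator g x := by
      by_cases hx : x ∈ E
      · have (s : α) : Function.update x q s ∈ E ∩ copyCoord p q ⁻¹' E ↔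
            Function.update x p s ∈ E := by
          rw [Set.mem_inter_iff, hq, Set.mem_preimage, copyCoord, Function.update_self,
            Function.update_comm hpq.symm, hq]
          exact and_iff_right hx
        simp only [this, Set.indicator_of_mem hx, g]
      · simp [Set.mem_inter_iff, hq, hx]
    simp_rw [h1]
    rw [lintegral_infinitePi_update ν p (hg.indicator hE)]
    refine lintegral_congr fun x => ?_
    have h2 (s : α) : E.indicator g (Function.update x p s) =
        {s | Function.update x p s ∈ E}.indicator (fun _ => g x) s := by
      simp only [Set.indicator, hgp]; rfl
    simp_rw [h2]
    rw [lintegral_indicator_const, sq]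
    exact (measurable_update_prod p).comp measurable_prodMk_left hE
  rw [key, infinitePi_apply_update ν p hE]
  exact lintegral_sq_le_lintegral_sq _ hg.aemeasurable

theorem infinitePi_eq_coord_null (ν : Measure α) [IsProbabilityMeasure ν] [NullSingletonClass ν]
    {p q : ι} (hpq : p ≠ q) (hm : MeasurableSet {x : ι → α | x p = x q}) :
    (Measure.infinitePi fun _ : ι => ν) {x | x p = x q} = 0 := by
  rw [infinitePi_apply_update ν p hm]
  simp [Function.update_of_ne hpq.symm]

end ProductMeasure

theorem exists_noAtoms_probabilityMeasure_cantor :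
    ∃ ν : Measure (ℕ → Bool), IsProbabilityMeasure ν ∧ NullSingletonClass ν := by
  let e : ℝ ≃ᵐ (ℕ → Bool) :=
    PolishSpace.measurableEquivNatBoolOfNotCountable (by simp)
  have : IsProbabilityMeasure (volume.restrict (Set.Icc (0 : ℝ) 1)) := ⟨by simp⟩
  refine ⟨(volume.restrict (Set.Icc (0 : ℝ) 1)).map e,
    Measure.isProbabilityMeasure_map e.measurable.aemeasurable, ⟨fun x => ?_⟩⟩
  rw [e.map_apply, ← e.image_symm]
  simp

/-- A quantitative pigeonhole: infinitely many events of probability bounded below contain one that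
meets infinitely many of them in probability bounded below. -/
theorem exists_frequently_le_measureReal_inter {Ω : Type*} [MeasurableSpace Ω] (μ : Measure Ω)
    [IsProbabilityMeasure μ] {G : ℕ → Set Ω} (hG : ∀ n, MeasurableSet (G n)) {ε : ℝ} (hε : 0 < ε)
    (hfr : ∃ᶠ n in atTop, ε ≤ μ.real (G n)) (N : ℕ) :
    ∃ n, N < n ∧ ∃ δ : ℝ, 0 < δ ∧ ∃ᶠ m in atTop, δ ≤ μ.real (G n ∩ G m) := by
  by_contra! hcon
  have htend (n : ℕ) (hn : N < n) : Tendsto (fun m => μ.real (G n ∩ G m)) atTop (𝓝 0) := by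
    refine tendsto_order.2 ⟨fun a ha => Eventually.of_forall fun m => ha.trans_le
      measureReal_nonneg, fun a ha => ?_⟩
    simpa using hcon n hn a ha
  have step (k : ℕ) : ∃ V, MeasurableSet V ∧ k * (ε / 2) ≤ μ.real V ∧
      Tendsto (fun m => μ.real (V ∩ G m)) atTop (𝓝 0) := by
    induction k with
    | zero => exact ⟨∅, MeasurableSet.empty, by simp, by simp⟩
    | succ k ih =>
      obtain ⟨V, hV, hk, ht⟩ := ih
      obtain ⟨n, ⟨hn, hVn⟩, hNn⟩ := ((hfr.and_eventually (ht.eventually_lt_const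
        (half_pos hε))).and_eventually (eventually_gt_atTop N)).exists
      refine ⟨V ∪ G n, hV.union (hG n), ?_, ?_⟩
      · have := measureReal_union_add_inter (μ := μ) (s := V) (hG n)
        push_cast
        linarith
      · refine squeeze_zero (fun _ => measureReal_nonneg) (fun m => ?_)
          (by simpa using ht.add (htend n hNn))
        rw [Set.union_inter_distrib_right]
        exact measureReal_union_le _ _
  obtain ⟨k, hk⟩ := exists_nat_gt (1 / (ε / 2))
  obtain ⟨V, -, hV, -⟩ := step k
  have h1 : μ.real V ≤ 1 := measureReal_le_one
  rw [div_lt_iff₀ (half_pos hε)] at hk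
  linarith

/-- The point that is split in two at step `j`; the first component names the axis it lives on. -/
def splitParent (j : ℕ) : ℕ × ℕ := (j.unpair.1, j.unpair.2.unpair.1)

/-- The point that is created at step `j`, on the same axis as `splitParent j`. -/
def splitChild (j : ℕ) : ℕ × ℕ := (j.unpair.1, j.unpair.2 + 1)

theorem splitParent_ne_splitChild {i j : ℕ} (h : i ≤ j) : splitParent i ≠ splitChild j := by
  intro he
  simp only [splitParent, splitChild, Prod.mk.injEq] at he
  have h1 := Nat.unpair_left_le i.unpair.2
  have h2 : i.unpair.2 ≤ j.unpair.2 := by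
    by_contra! hlt
    have := Nat.pair_lt_pair_right i.unpair.1 hlt
    rw [Nat.pair_unpair, he.1, Nat.pair_unpair] at this
    omega
  omega

theorem splitChild_injective : Function.Injective splitChild := by
  intro i j h
  simp only [splitChild, Prod.mk.injEq, add_left_inj] at h
  rw [← Nat.pair_unpair i, ← Nat.pair_unpair j, h.1, h.2]

section Grid

variable {α : Type*}

/-- The configurations for which every transversal of the points present before step `j` lies
in `A`. -/
def gridSet (A : Set (ℕ → α)) : ℕ → Set (ℕ × ℕ → α)
  | 0 => {x | (fun k => x (k, 0)) ∈ A}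
  | j + 1 => gridSet A j ∩ copyCoord (splitParent j) (splitChild j) ⁻¹' gridSet A j

/-- The points present before step `j`. -/
def IsPresent (j : ℕ) (v : ℕ × ℕ) : Prop := v.2 = 0 ∨ ∃ i < j, v = splitChild i

theorem isPresent_splitParent (j : ℕ) : IsPresent j (splitParent j) := by
  rcases h : (splitParent j).2 with _ | c
  · exact Or.inl h
  · refine Or.inr ⟨Nat.pair (splitParent j).1 c, ?_, ?_⟩
    · have h1 := Nat.unpair_left_le j.unpair.2
      simp only [splitParent] at h ⊢
      conv_rhs => rw [← Nat.pair_unpair j]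
      exact Nat.pair_lt_pair_right _ (by omega)
    · simp [splitChild, ← h]

theorem mem_of_mem_gridSet {A : Set (ℕ → α)} {j : ℕ} {x : ℕ × ℕ → α} (hx : x ∈ gridSet A j)
    (a : ℕ → ℕ) (ha : ∀ k, IsPresent j (k, a k)) : (fun k => x (k, a k)) ∈ A := by
  induction j generalizing x a with
  | zero =>
    have h0 (k : ℕ) : a k = 0 := by simpa [IsPresent] using ha k
    simp only [h0]
    exact hx
  | succ j ih =>
    set k₀ := (splitParent j).1 with hk₀
    by_cases hc : (k₀, a k₀) = splitChild j
    · have := ih hx.2 (Function.update a k₀ (splitParent j).2) fun k => ?_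
      · convert this using 2 with k
        by_cases hk : k = k₀
        · subst hk
          rw [hc, hk₀, Function.update_self, copyCoord, Function.update_self]
        · rw [Function.update_of_ne hk, copyCoord, Function.update_of_ne]
          exact fun h => hk (congrArg Prod.fst h)
      · by_cases hk : k = k₀
        · subst hk
          simpa [hk₀] using isPresent_splitParent j
        · rw [Function.update_of_ne hk]
          rcases ha k with h | ⟨i, hi, h⟩
          · exact Or.inl h
          · rcases Nat.lt_succ_iff_lt_or_eq.1 hi with hij | rfl
            · exact Or.inr ⟨i, hij, h⟩
            · exact absurd (congrArg Prod.fst h) hk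
    · refine ih hx.1 a fun k => ?_
      rcases ha k with h | ⟨i, hi, h⟩
      · exact Or.inl h
      · rcases Nat.lt_succ_iff_lt_or_eq.1 hi with hij | rfl
        · exact Or.inr ⟨i, hij, h⟩
        · have hk : k = k₀ := congrArg Prod.fst h
          subst hk
          exact absurd h hc

variable [TopologicalSpace α]

theorem continuous_copyCoord {ι : Type*} [DecidableEq ι] (p q : ι) :
    Continuous (copyCoord (α := α) p q) :=
  continuous_id.update p (continuous_apply q)

theorem isClopen_gridSet {A : Set (ℕ → α)} (hA : IsClopen A) (j : ℕ) :
    IsClopen (gridSet A j) := by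
  induction j with
  | zero => exact hA.preimage (continuous_pi fun k => continuous_apply _)
  | succ j ih => exact ih.inter (ih.preimage (continuous_copyCoord _ _))

end Grid

/-- Membership in `W` does not depend on the coordinate `r`. -/
def IgnoresCoord {ι α : Type*} [DecidableEq ι] (r : ι) (W : Set (ι → α)) : Prop :=
  ∀ x t, Function.update x r t ∈ W ↔ x ∈ W

namespace IgnoresCoord

variable {ι α : Type*} [DecidableEq ι] {r p q : ι} {V W : Set (ι → α)}

theorem inter (hV : IgnoresCoord r V) (hW : IgnoresCoord r W) : IgnoresCoord r (V ∩ W) :=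
  fun x t => and_congr (hV x t) (hW x t)

theorem diff (hV : IgnoresCoord r V) (hW : IgnoresCoord r W) : IgnoresCoord r (V \ W) :=
  fun x t => and_congr (hV x t) (not_congr (hW x t))

theorem preimage_copyCoord (hW : IgnoresCoord r W) (hp : p ≠ r) (hq : q ≠ r) :
    IgnoresCoord r (copyCoord p q ⁻¹' W) := fun x t => by
  rw [Set.mem_preimage, Set.mem_preimage, copyCoord, Function.update_of_ne hq,
    Function.update_comm hp.symm, hW, copyCoord]

end IgnoresCoord

theorem ignoresCoord_gridSet {α : Type*} (A : Set (ℕ → α)) {i j : ℕ} (h : j ≤ i) :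
    IgnoresCoord (splitChild i) (gridSet A j) := by
  induction j with
  | zero =>
    intro x t
    have (k : ℕ) : (k, 0) ≠ splitChild i := by simp [splitChild]
    simp [gridSet, Function.update_of_ne (this _)]
  | succ j ih =>
    exact (ih (by omega)).inter ((ih (by omega)).preimage_copyCoord
      (splitParent_ne_splitChild (by omega)) fun he => by
        have := splitChild_injective he; omega)

theorem isClopen_setOf_apply_eq {ι : Type*} (p : ι) (b : ℕ) (c : (ι → ℕ → Bool) → Bool)
    (hc : Continuous c) : IsClopen {x : ι → ℕ → Bool | x p b = c x} := by
  have : Continuous fun x : ι → ℕ → Bool => (x p b, c x) := by fun_prop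
  exact (isClopen_discrete {z : Bool × Bool | z.1 = z.2}).preimage this

theorem isClopen_setOf_forall_lt_eq {ι : Type*} (p q : ι) (M : ℕ) :
    IsClopen {x : ι → ℕ → Bool | ∀ b < M, x p b = x q b} := by
  have : {x : ι → ℕ → Bool | ∀ b < M, x p b = x q b} =
      ⋂ b ∈ Finset.range M, {x | x p b = x q b} := by ext; simp
  rw [this]
  exact isClopen_biInter_finset fun b _ => isClopen_setOf_apply_eq p b _ (by fun_prop)

theorem exists_measureReal_agree_lt {ι : Type*} [DecidableEq ι] [Countable ι]
    (ν : Measure (ℕ → Bool))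
    [IsProbabilityMeasure ν] [NullSingletonClass ν] {p q : ι} (hpq : p ≠ q) {ε : ℝ} (hε : 0 < ε) :
    ∃ M, (Measure.infinitePi fun _ : ι => ν).real {x | ∀ b < M, x p b = x q b} < ε := by
  set μ := Measure.infinitePi fun _ : ι => ν
  have hm (M : ℕ) : MeasurableSet {x : ι → ℕ → Bool | ∀ b < M, x p b = x q b} :=
    (isClopen_setOf_forall_lt_eq p q M).isOpen.measurableSet
  have hI : ⋂ M, {x : ι → ℕ → Bool | ∀ b < M, x p b = x q b} = {x | x p = x q} := by
    ext x
    simp only [Set.mem_iInter, Set.mem_ofPred_eq]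
    exact ⟨fun h => funext fun b => h (b + 1) b b.lt_succ_self, fun h _ b _ => congrFun h b⟩
  have h0 : μ {x | x p = x q} = 0 :=
    infinitePi_eq_coord_null ν hpq (hI ▸ MeasurableSet.iInter hm)
  have ht := tendsto_measure_iInter_atTop (μ := μ) (fun M => (hm M).nullMeasurableSet)
    (fun M N hMN x hx b hb => hx b (hb.trans_le hMN)) ⟨0, measure_ne_top _ _⟩
  rw [hI, h0] at ht
  have ht' := (ENNReal.tendsto_toReal ENNReal.zero_ne_top).comp ht
  exact (ht'.eventually_lt_const (by simpa using hε)).exists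

/-- One splitting step of the fusion. -/
theorem exists_split (ν : Measure (ℕ → Bool)) [IsProbabilityMeasure ν] [NullSingletonClass ν]
    {A : ℕ → Set (ℕ → ℕ → Bool)} (hA : ∀ n, IsClopen (A n)) {j : ℕ}
    {W : Set (ℕ × ℕ → ℕ → Bool)} (hW : IsClopen W)
    (hWi : ∀ i ≥ j, IgnoresCoord (splitChild i) W)
    (hfr : ∃ ε : ℝ, 0 < ε ∧ ∃ᶠ n in atTop,
      ε ≤ (Measure.infinitePi fun _ => ν).real (W ∩ gridSet (A n) j)) (L N : ℕ) :
    ∃ n W', N < n ∧ IsClopen W' ∧ (∀ i ≥ j + 1, IgnoresCoord (splitChild i) W') ∧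
      (∃ ε : ℝ, 0 < ε ∧ ∃ᶠ m in atTop,
        ε ≤ (Measure.infinitePi fun _ => ν).real (W' ∩ gridSet (A m) (j + 1))) ∧
      W' ⊆ W ∧ W' ⊆ gridSet (A n) (j + 1) ∧
      ∀ x ∈ W', x (splitParent j) ≠ x (splitChild j) ∧
        ∀ b < L, x (splitParent j) b = x (splitChild j) b := by
  set μ := Measure.infinitePi fun _ : ℕ × ℕ => ν
  obtain ⟨ε, hε, hfr⟩ := hfr
  set p := splitParent j
  set q := splitChild j
  have hpq : p ≠ q := splitParent_ne_splitChild le_rfl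
  let C (s : Fin L → Bool) : Set (ℕ × ℕ → ℕ → Bool) := {x | ∀ b : Fin L, x p b = s b}
  have hCc (s : Fin L → Bool) : IsClopen (C s) := by
    have : C s = ⋂ b : Fin L, {x | x p b = s b} := by ext; simp [C]
    rw [this]
    exact isClopen_iInter_of_finite fun b => isClopen_setOf_apply_eq p b _ continuous_const
  obtain ⟨s, η, hη, hs⟩ : ∃ s, ∃ η : ℝ, 0 < η ∧
      ∃ᶠ n in atTop, η ≤ μ.real (W ∩ gridSet (A n) j ∩ C s) := by
    by_contra! hcon
    set c : ℝ := (Fintype.card (Fin L → Bool) : ℝ)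
    have hc : 0 ≤ c := Nat.cast_nonneg _
    have hall : ∀ᶠ n in atTop, ∀ s, μ.real (W ∩ gridSet (A n) j ∩ C s) < ε / (c + 1) :=
      eventually_all.2 fun s => by simpa using hcon s (ε / (c + 1)) (by positivity)
    obtain ⟨n, hn, hlt⟩ := (hfr.and_eventually hall).exists
    have hU : W ∩ gridSet (A n) j = ⋃ s, W ∩ gridSet (A n) j ∩ C s := by
      rw [← Set.inter_iUnion, (Set.iUnion_eq_univ_iff (f := C)).2 fun x =>
        ⟨fun b => x p b, fun _ => rfl⟩, Set.inter_univ]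
    have hle : μ.real (W ∩ gridSet (A n) j) ≤ c * (ε / (c + 1)) := by
      rw [hU]
      refine (measureReal_iUnion_fintype_le _).trans
        ((Finset.sum_le_sum fun s _ => (hlt s).le).trans_eq ?_)
      simp [c]
    have : c * (ε / (c + 1)) < ε := by
      rw [mul_div_assoc', div_lt_iff₀ (by positivity)]
      nlinarith
    linarith
  obtain ⟨M, hM⟩ := exists_measureReal_agree_lt ν hpq (half_pos (pow_pos hη 2))
  let D : Set (ℕ × ℕ → ℕ → Bool) := {x | ∀ b < M, x p b = x q b}
  let G (n : ℕ) : Set (ℕ × ℕ → ℕ → Bool) := W ∩ gridSet (A n) j ∩ C s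
  let V (n : ℕ) : Set (ℕ × ℕ → ℕ → Bool) := (G n ∩ copyCoord p q ⁻¹' G n) \ D
  have hDc : IsClopen D := isClopen_setOf_forall_lt_eq p q M
  have hGc (n : ℕ) : IsClopen (G n) := (hW.inter (isClopen_gridSet (hA n) j)).inter (hCc s)
  have hVc (n : ℕ) : IsClopen (V n) :=
    ((hGc n).inter ((hGc n).preimage (continuous_copyCoord p q))).diff hDc
  have hpc {i : ℕ} (hi : j ≤ i) : p ≠ splitChild i := splitParent_ne_splitChild hi
  have hGi (n : ℕ) {i : ℕ} (hi : j ≤ i) : IgnoresCoord (splitChild i) (G n) := by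
    refine ((hWi i hi).inter (ignoresCoord_gridSet _ hi)).inter fun x t => ?_
    simp [C, Function.update_of_ne (hpc hi)]
  have hqc {i : ℕ} (hi : j + 1 ≤ i) : q ≠ splitChild i := fun he => by
    have := splitChild_injective he; omega
  have hVi (n : ℕ) : ∀ i ≥ j + 1, IgnoresCoord (splitChild i) (V n) := fun i hi => by
    have hji : j ≤ i := by omega
    refine ((hGi n hji).inter ((hGi n hji).preimage_copyCoord (hpc hji) (hqc hi))).diff
      fun x t => ?_
    simp [D, Function.update_of_ne (hpc hji), Function.update_of_ne (hqc hi)]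
  have hVlarge : ∃ᶠ n in atTop, η ^ 2 / 2 ≤ μ.real (V n) := by
    refine hs.mono fun n hn => ?_
    have h1 : μ.real (G n) ^ 2 ≤ μ.real (G n ∩ copyCoord p q ⁻¹' G n) := by
      have := sq_measure_le_measure_inter_copyCoord ν hpq (hGc n).isOpen.measurableSet
        (hGi n (le_refl j))
      rw [measureReal_def, measureReal_def, ← ENNReal.toReal_pow]
      exact ENNReal.toReal_mono (measure_ne_top _ _) this
    have h2 : μ.real (G n ∩ copyCoord p q ⁻¹' G n) - μ.real D ≤ μ.real (V n) :=
      le_measureReal_sdiff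
    have h3 : η ^ 2 ≤ μ.real (G n) ^ 2 := pow_le_pow_left₀ hη.le hn 2
    linarith
  have hVgrid (n : ℕ) : V n ⊆ gridSet (A n) (j + 1) := fun x hx => ⟨hx.1.1.1.2, hx.1.2.1.2⟩
  obtain ⟨n, hn, δ, hδ, hδfr⟩ := exists_frequently_le_measureReal_inter μ
    (fun n => (hVc n).isOpen.measurableSet) (half_pos (pow_pos hη 2)) hVlarge N
  refine ⟨n, V n, hn, hVc n, hVi n, ⟨δ, hδ, hδfr.mono fun m hm => hm.trans ?_⟩,
    fun x hx => hx.1.1.1.1, hVgrid n, fun x hx => ⟨fun he => hx.2 fun b _ => congrFun he b,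
      fun b hb => ?_⟩⟩
  · exact measureReal_mono (Set.inter_subset_inter_right _ (hVgrid m))
  · have h1 : x p b = s ⟨b, hb⟩ := hx.1.1.2 ⟨b, hb⟩
    have h2 : copyCoord p q x p b = s ⟨b, hb⟩ := hx.1.2.2 ⟨b, hb⟩
    rw [copyCoord, Function.update_self] at h2
    rw [h1, h2]

theorem exists_forall_agree_imp_eq {f : (ℕ → ℕ → Bool) → Bool} (hf : Continuous f) :
    ∃ L, ∀ z z' : ℕ → ℕ → Bool, (∀ k, ∀ b < L, z k b = z' k b) → f z = f z' := by
  by_contra! hcon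
  choose z z' hzz hne using hcon
  obtain ⟨y, φ, hφ, hy⟩ := CompactSpace.tendsto_subseq z
  have hy' : Tendsto (z' ∘ φ) atTop (𝓝 y) := by
    refine tendsto_pi_nhds.2 fun k => tendsto_pi_nhds.2 fun b => ?_
    refine ((tendsto_pi_nhds.1 (tendsto_pi_nhds.1 hy k)) b).congr' ?_
    filter_upwards [eventually_gt_atTop b] with i hi
    exact hzz _ k b (hi.trans_le (hφ.id_le i))
  have h1 := ((hf.tendsto y).comp hy).eventually_mem (isOpen_discrete {f y} |>.mem_nhds rfl)
  have h2 := ((hf.tendsto y).comp hy').eventually_mem (isOpen_discrete {f y} |>.mem_nhds rfl)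
  obtain ⟨i, hi, hi'⟩ := (h1.and h2).exists
  exact hne (φ i) (Eq.trans hi (Eq.symm hi'))

/-- The fusion: a grid of points all of whose transversals lie, up to a prescribed precision, in
infinitely many of the sets `A n`. -/
theorem exists_fusion (ν : Measure (ℕ → Bool)) [IsProbabilityMeasure ν] [NullSingletonClass ν]
    {A : ℕ → Set (ℕ → ℕ → Bool)} (hA : ∀ n, IsClopen (A n)) (l : ℕ → ℕ)
    (hfr : ∃ ε : ℝ, 0 < ε ∧ ∃ᶠ n in atTop,
      ε ≤ (Measure.infinitePi fun _ => ν).real (gridSet (A n) 0)) :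
    ∃ (φ L : ℕ → ℕ) (x : ℕ × ℕ → ℕ → Bool), StrictMono φ ∧ Monotone L ∧ (∀ j, j ≤ L j) ∧
      (∀ j, l (φ j) ≤ L (j + 1)) ∧ (∀ j, x ∈ gridSet (A (φ j)) (j + 1)) ∧
      ∀ j, x (splitParent j) ≠ x (splitChild j) ∧
        ∀ b < L j, x (splitParent j) b = x (splitChild j) b := by
  set μ := Measure.infinitePi fun _ : ℕ × ℕ => ν
  let Good (j : ℕ) (s : Set (ℕ × ℕ → ℕ → Bool) × ℕ) : Prop :=
    IsClopen s.1 ∧ (∀ i ≥ j, IgnoresCoord (splitChild i) s.1) ∧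
      ∃ ε : ℝ, 0 < ε ∧ ∃ᶠ n in atTop, ε ≤ μ.real (s.1 ∩ gridSet (A n) j)
  let prec (j n : ℕ) : ℕ := j + ∑ m ∈ Finset.range (n + 1), l m
  let Step (j : ℕ) (s s' : Set (ℕ × ℕ → ℕ → Bool) × ℕ) : Prop :=
    s.2 < s'.2 ∧ s'.1 ⊆ s.1 ∧ s'.1 ⊆ gridSet (A s'.2) (j + 1) ∧
      ∀ x ∈ s'.1, x (splitParent j) ≠ x (splitChild j) ∧
        ∀ b < prec j s.2, x (splitParent j) b = x (splitChild j) b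
  have hstep (j s) (hs : Good j s) : ∃ s', Good (j + 1) s' ∧ Step j s s' := by
    obtain ⟨n, W', h1, h2, h3, h4, h5, h6, h7⟩ :=
      exists_split ν hA hs.1 hs.2.1 hs.2.2 (prec j s.2) s.2
    exact ⟨(W', n), ⟨h2, h3, h4⟩, h1, h5, h6, h7⟩
  choose! next hgood hnext using hstep
  let S (j : ℕ) : Set (ℕ × ℕ → ℕ → Bool) × ℕ := Nat.rec (Set.univ, 0) next j
  have hS (j : ℕ) : Good j (S j) := by
    induction j with
    | zero => exact ⟨isClopen_univ, fun i _ x t => by simp [S], by simpa [S] using hfr⟩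
    | succ j ih => exact hgood j _ ih
  have hSS (j : ℕ) : Step j (S j) (S (j + 1)) := hnext j _ (hS j)
  obtain ⟨x, hx⟩ : (⋂ j, (S j).1).Nonempty := by
    refine IsCompact.nonempty_iInter_of_sequence_nonempty_isCompact_isClosed _
      (fun j => (hSS j).2.1) (fun j => ?_) (hS 0).1.isClosed.isCompact fun j => (hS j).1.isClosed
    obtain ⟨ε, hε, h⟩ := (hS j).2.2
    obtain ⟨n, hn⟩ := h.exists
    have hne : μ.real ((S j).1 ∩ gridSet (A n) j) ≠ 0 := (hε.trans_le hn).ne'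
    exact (nonempty_of_measureReal_ne_zero hne).left
  have hmono : StrictMono fun j => (S j).2 := strictMono_nat_of_lt_succ fun j => (hSS j).1
  have hxS (j : ℕ) : x ∈ (S j).1 := Set.mem_iInter.1 hx j
  refine ⟨fun j => (S (j + 1)).2, fun j => prec j (S j).2, x,
    fun i j hij => hmono (Nat.succ_lt_succ hij), fun i j hij => ?_, fun j => Nat.le_add_right _ _,
    fun j => ?_, fun j => (hSS j).2.2.1 (hxS (j + 1)),
    fun j => (hSS j).2.2.2 x (hxS (j + 1))⟩
  · refine add_le_add hij (Finset.sum_le_sum_of_subset (Finset.range_subset_range.2 ?_))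
    exact Nat.succ_le_succ (hmono.monotone hij)
  · refine le_trans ?_ (Nat.le_add_left _ _)
    exact Finset.single_le_sum (f := l) (fun _ _ => Nat.zero_le _)
      (Finset.self_mem_range_succ _)

theorem exists_isPresent_agree {L : ℕ → ℕ} (hL : Monotone L) {x : ℕ × ℕ → ℕ → Bool}
    (hx : ∀ j, ∀ b < L j, x (splitParent j) b = x (splitChild j) b) (j k c : ℕ) :
    ∃ c', IsPresent j (k, c') ∧ ∀ b < L j, x (k, c) b = x (k, c') b := by
  induction c using Nat.strong_induction_on with
  | _ c ih =>
    rcases c with _ | a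
    · exact ⟨0, Or.inl rfl, fun _ _ => rfl⟩
    · by_cases hj : Nat.pair k a < j
      · exact ⟨a + 1, Or.inr ⟨_, hj, by simp [splitChild]⟩, fun _ _ => rfl⟩
      · obtain ⟨c', h1, h2⟩ := ih a.unpair.1 (Nat.lt_succ_of_le (Nat.unpair_left_le a))
        refine ⟨c', h1, fun b hb => (h2 b hb).symm ▸ ?_⟩
        have := hx (Nat.pair k a) b (hb.trans_le (hL (not_lt.1 hj)))
        simp only [splitParent, splitChild, Nat.unpair_pair] at this
        exact this.symm

theorem preperfect_range_of_split {L : ℕ → ℕ} (hL : ∀ j, j ≤ L j) {x : ℕ × ℕ → ℕ → Bool}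
    (hx : ∀ j, x (splitParent j) ≠ x (splitChild j) ∧
      ∀ b < L j, x (splitParent j) b = x (splitChild j) b) (k : ℕ) :
    Preperfect (Set.range fun c => x (k, c)) := by
  rintro _ ⟨c, rfl⟩
  rw [accPt_iff_nhds]
  intro U hU
  let J (N : ℕ) : ℕ := Nat.pair k (Nat.pair c N)
  have hJN (N : ℕ) : N ≤ J N := (Nat.right_le_pair c N).trans (Nat.right_le_pair k _)
  have hp (N : ℕ) : splitParent (J N) = (k, c) := by simp [splitParent, J]
  have ht : Tendsto (fun N => x (splitChild (J N))) atTop (𝓝 (x (k, c))) := by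
    refine tendsto_pi_nhds.2 fun b => tendsto_const_nhds.congr' ?_
    filter_upwards [eventually_gt_atTop b] with N hN
    have := (hx (J N)).2 b (hN.trans_le ((hJN N).trans (hL _)))
    rwa [hp] at this
  obtain ⟨N, hN⟩ := (ht.eventually_mem hU).exists
  refine ⟨_, ⟨hN, Nat.pair c N + 1, by simp [splitChild, J]⟩, ?_⟩
  have := (hx (J N)).1
  rw [hp] at this
  exact this.symm

theorem stmt9 (f : ℕ → (ℕ → (ℕ → Bool)) → Bool) (hf : ∀ n, Continuous (f n)) :
    ∃ φ : ℕ → ℕ, StrictMono φ ∧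
      ∃ P : ℕ → Set (ℕ → Bool),
        (∀ k, (P k).Nonempty ∧ Perfect (P k)) ∧
        ∀ x ∈ Set.pi Set.univ P, ∃ b : Bool,
          Tendsto (fun i => f (φ i) x) atTop (nhds b) := by
  obtain ⟨ν, _, _⟩ := exists_noAtoms_probabilityMeasure_cantor
  have hclopen (b : Bool) (n : ℕ) : IsClopen {z | f n z = b} :=
    (isClopen_discrete {b}).preimage (hf n)
  obtain ⟨b, hb⟩ : ∃ b, ∃ᶠ n in atTop, (1 / 2 : ℝ) ≤
      (Measure.infinitePi fun _ => ν).real (gridSet {z | f n z = b} 0) := by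
    by_contra hcon
    rw [not_exists] at hcon
    obtain ⟨n, h1, h2⟩ :=
      ((not_frequently.1 (hcon true)).and (not_frequently.1 (hcon false))).exists
    rw [not_le] at h1 h2
    have hU : gridSet {z | f n z = true} 0 ∪ gridSet {z | f n z = false} 0 = Set.univ := by
      ext x
      cases h : f n (fun k => x (k, 0)) <;> simp [gridSet, h]
    have := measureReal_union_le (μ := Measure.infinitePi fun _ : ℕ × ℕ => ν)
      (gridSet {z | f n z = true} 0) (gridSet {z | f n z = false} 0)
    rw [hU, probReal_univ] at this
    linarith
  choose l hl using fun n => exists_forall_agree_imp_eq (hf n)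
  obtain ⟨φ, L, x, hφ, hLm, hL, hlL, hgrid, hx⟩ :=
    exists_fusion ν (hclopen b) l ⟨1 / 2, by norm_num, hb⟩
  refine ⟨φ, hφ, fun k => closure (Set.range fun c => x (k, c)), fun k =>
    ⟨(Set.range_nonempty _).closure, (preperfect_range_of_split hL hx k).perfect_closure⟩,
    fun z hz => ⟨b, ?_⟩⟩
  refine tendsto_const_nhds.congr fun j => Eq.symm ?_
  rw [← closure_pi_set] at hz
  refine closure_minimal ?_ (hclopen b (φ j)).isClosed hz
  intro y hy
  choose a ha using fun k => hy k (Set.mem_univ k)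
  choose a' hpres hagree using fun k =>
    exists_isPresent_agree hLm (fun j => (hx j).2) (j + 1) k (a k)
  have hmem := mem_of_mem_gridSet (hgrid j) a' hpres
  refine (hl (φ j) y (fun k => x (k, a' k)) fun k b hb => ?_).trans hmem
  rw [← hagree k b (hb.trans_le (hlL j)), ← ha k]
end

section
/- Let f_n : (2^ω)^ω → 2^ω be continuous functions. Then there exist an infinite set N ⊆ ω and nonempty perfect sets P_k ⊆ 2^ω for k ∈ ω such that the subsequence (f_n)_{n ∈ N} converges pointwise on ∏_{k∈ω} P_k. -/
open Filter
namespace PerfectProduct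
open MeasureTheory Measure Function Set

section Measure

variable {ι α : Type*} [DecidableEq ι] [MeasurableSpace α]

theorem map_update_infinitePi (ν : Measure α) [IsProbabilityMeasure ν] (p : ι) :
    ((infinitePi fun _ : ι => ν).prod ν).map (fun z => update z.1 p z.2) =
      infinitePi fun _ : ι => ν := by
  have hm : Measurable (fun z : (ι → α) × α => update z.1 p z.2) := measurable_update'
  refine eq_infinitePi _ fun s t ht => ?_
  rw [map_apply hm (MeasurableSet.pi s.countable_toSet fun i _ => ht i)]
  by_cases hp : p ∈ s
  · have : (fun z : (ι → α) × α => update z.1 p z.2) ⁻¹' (Set.pi s t) =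
        (Set.pi (s.erase p) t) ×ˢ t p := by
      ext ⟨y, a⟩
      simp only [mem_preimage, Set.mem_pi, mem_prod, Finset.mem_coe, Finset.mem_erase]
      constructor
      · intro h
        refine ⟨fun i hi => ?_, by simpa using h p hp⟩
        simpa [hi.1] using h i hi.2
      · rintro ⟨h1, h2⟩ i hi
        by_cases hip : i = p
        · subst hip; simpa using h2
        · simpa [hip] using h1 i ⟨hip, hi⟩
    rw [this, prod_prod, infinitePi_pi _ (fun i _ => ht i), Finset.prod_erase_mul _ _ hp]
  · have : (fun z : (ι → α) × α => update z.1 p z.2) ⁻¹' (Set.pi s t) =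
        (Set.pi s t) ×ˢ univ := by
      ext ⟨y, a⟩
      simp only [mem_preimage, Set.mem_pi, mem_prod, Finset.mem_coe, mem_univ, and_true]
      refine forall₂_congr fun i hi => ?_
      rw [update_of_ne (by rintro rfl; exact hp hi)]
    rw [this, prod_prod, infinitePi_pi _ (fun i _ => ht i), measure_univ, mul_one]

theorem lintegral_infinitePi_update (ν : Measure α) [IsProbabilityMeasure ν] (p : ι)
    {g : (ι → α) → ENNReal} (hg : Measurable g) :
    ∫⁻ y, g y ∂(infinitePi fun _ : ι => ν) =
      ∫⁻ y, ∫⁻ a, g (update y p a) ∂ν ∂(infinitePi fun _ : ι => ν) := by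
  have hm : Measurable (fun z : (ι → α) × α => update z.1 p z.2) := measurable_update'
  conv_lhs => rw [← map_update_infinitePi ν p]
  rw [lintegral_map hg hm]
  exact lintegral_prod _ (hg.comp hm).aemeasurable

theorem sq_lintegral_le {Ω : Type*} [MeasurableSpace Ω] (μ : Measure Ω) [IsProbabilityMeasure μ]
    {h : Ω → ENNReal} (hh : Measurable h) (hfin : ∫⁻ y, h y ∂μ ≠ ⊤) :
    (∫⁻ y, h y ∂μ) ^ 2 ≤ ∫⁻ y, h y ^ 2 ∂μ := by
  set d := ∫⁻ y, h y ∂μ with hd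
  have key : ∫⁻ y, 2 * d * h y ∂μ ≤ ∫⁻ y, (h y ^ 2 + d ^ 2) ∂μ := by
    refine lintegral_mono fun y => ?_
    rcases eq_or_ne (h y) ⊤ with ht | ht
    · simp [ht]
    · lift h y to NNReal using ht with a
      lift d to NNReal using hfin with b
      norm_cast
      have := two_mul_le_add_sq b a
      rw [add_comm]; exact this
  rw [lintegral_const_mul _ hh, lintegral_add_right _ measurable_const, lintegral_const,
    measure_univ, mul_one, ← hd] at key
  have h2 : d ^ 2 + d ^ 2 ≤ ∫⁻ y, h y ^ 2 ∂μ + d ^ 2 := by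
    calc d ^ 2 + d ^ 2 = 2 * d * d := by ring
      _ ≤ _ := key
  exact (ENNReal.add_le_add_iff_right (by simp [hfin])).1 h2

/-- Splitting the coordinate `p` of a point of `C` into two distinct values, the second one stored
in an irrelevant coordinate `p'`, loses at most a square in measure. -/
theorem sq_measure_le_measure_duplicate [MeasurableEq α] [MeasurableSingletonClass α]
    (ν : Measure α) [IsProbabilityMeasure ν]
    [NullSingletonClass ν] {C : Set (ι → α)} (hC : MeasurableSet C) {p p' : ι} (hpp : p ≠ p')
    (hp' : ∀ y a, update y p' a ∈ C ↔ y ∈ C) :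
    (infinitePi fun _ : ι => ν) C ^ 2 ≤
      (infinitePi fun _ : ι => ν) {y | y ∈ C ∧ update y p (y p') ∈ C ∧ y p ≠ y p'} := by
  set μ := infinitePi fun _ : ι => ν
  have hm : Measurable (fun z : (ι → α) × α => update z.1 p z.2) := measurable_update'
  set D : Set (ι → α) := {y | y ∈ C ∧ update y p (y p') ∈ C ∧ y p ≠ y p'}
  have hD : MeasurableSet D := by
    refine hC.inter (MeasurableSet.inter ?_ ?_)
    · exact (hm.comp (measurable_id.prodMk (measurable_pi_apply p'))) hC
    · exact (measurableSet_eq_fun (measurable_pi_apply p) (measurable_pi_apply p')).compl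
  set h : (ι → α) → ENNReal := fun y => ν {a | update y p a ∈ C}
  have hhm : Measurable h := measurable_measure_prodMk_left (hm hC)
  have hsec : ∀ y, MeasurableSet {a | update y p a ∈ C} := fun y => (measurable_update y) hC
  have h1 : μ C = ∫⁻ y, h y ∂μ := by
    rw [← lintegral_indicator_one hC,
      lintegral_infinitePi_update ν p (measurable_one.indicator hC)]
    refine lintegral_congr fun y => ?_
    exact lintegral_indicator_one (hsec y)
  have hinner : ∀ y a, ∫⁻ b, D.indicator 1 (update (update y p a) p' b) ∂ν =
      {a | update y p a ∈ C}.indicator (fun _ => h y) a := by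
    intro y a
    by_cases ha : update y p a ∈ C
    · rw [indicator_of_mem (by exact ha)]
      have : ∀ b, D.indicator (1 : (ι → α) → ENNReal) (update (update y p a) p' b) =
          ({b | update y p b ∈ C} \ {a}).indicator 1 b := by
        intro b
        have : update (update y p a) p' b ∈ D ↔ b ∈ {b | update y p b ∈ C} \ {a} := by
          simp only [D, mem_ofPred_eq, hp', update_self, update_of_ne hpp, Set.mem_sdiff,
            mem_singleton_iff]
          rw [update_comm hpp.symm, update_idem, hp']
          simp only [ha, true_and, ne_eq, eq_comm]
        by_cases hb : b ∈ {b | update y p b ∈ C} \ {a}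
        · rw [indicator_of_mem hb, indicator_of_mem (this.2 hb)]; rfl
        · rw [indicator_of_notMem hb, indicator_of_notMem (fun h => hb (this.1 h))]
      simp_rw [this]
      rw [lintegral_indicator_one ((hsec y).diff (measurableSet_singleton a))]
      exact measure_sdiff_null (measure_singleton a)
    · rw [indicator_of_notMem (by exact ha)]
      refine (lintegral_congr fun b => ?_).trans lintegral_zero
      refine indicator_of_notMem (fun hb => ha ?_) _
      exact (hp' _ _).1 hb.1
  have h2 : μ D = ∫⁻ y, h y ^ 2 ∂μ := by
    have hDm : Measurable (D.indicator (1 : (ι → α) → ENNReal)) := measurable_one.indicator hD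
    have hm' : Measurable (fun z : (ι → α) × α => update z.1 p' z.2) := measurable_update'
    rw [← lintegral_indicator_one hD, lintegral_infinitePi_update ν p' hDm,
      lintegral_infinitePi_update ν p (by exact (hDm.comp hm').lintegral_prod_right')]
    refine lintegral_congr fun y => ?_
    simp_rw [hinner]
    rw [lintegral_indicator_const (hsec y), sq]
  rw [h1, h2]
  exact sq_lintegral_le μ hhm (by rw [← h1]; exact measure_ne_top _ _)

end Measure
noncomputable def coinMeasure : Measure (ℕ → Bool) :=
  infinitePi fun _ => (PMF.uniformOfFintype Bool).toMeasure

instance : IsProbabilityMeasure coinMeasure := by unfold coinMeasure; infer_instance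

instance : NullSingletonClass coinMeasure where
  measure_singleton x := by
    have ht := ENNReal.tendsto_pow_atTop_nhds_zero_of_lt_one (r := 2⁻¹) (by simp)
    refine le_antisymm (ge_of_tendsto' ht fun n => ?_) bot_le
    calc coinMeasure {x} ≤ coinMeasure (Set.pi (Finset.range n) fun i => {x i}) :=
          measure_mono fun y hy i _ => by rw [hy]; rfl
      _ = 2⁻¹ ^ n := by
        rw [coinMeasure, infinitePi_pi _ fun i _ => measurableSet_singleton _]
        simp

theorem exists_fiber_le {Ω T : Type*} [MeasurableSpace Ω] [Finite T] (μ : Measure Ω)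
    [IsFiniteMeasure μ] (U : Ultrafilter ℕ) {A : ℕ → Set Ω} {δ : ENNReal} (hδ : δ ≠ 0)
    (hA : ∀ᶠ n in U, δ ≤ μ (A n)) (g : ℕ → Ω → T) :
    ∃ t, ∃ ε : ENNReal, ε ≠ 0 ∧ ∀ᶠ n in U, ε ≤ μ (A n ∩ {y | g n y = t}) := by
  have := Fintype.ofFinite T
  have hδ' : δ ≠ ⊤ := by
    obtain ⟨n, hn⟩ := hA.exists
    exact (hn.trans_lt (measure_lt_top μ _)).ne
  refine exists_comm.1 ⟨δ / (Fintype.card T + 1), ?_⟩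
  rw [exists_and_left]
  refine ⟨ENNReal.div_ne_zero.2 ⟨hδ, by simp⟩, ?_⟩
  rw [← Ultrafilter.eventually_exists_iff]
  filter_upwards [hA] with n hn
  by_contra! hlt
  have h1 : μ (A n) ≤ ∑ t, μ (A n ∩ {y | g n y = t}) := by
    refine (measure_mono fun y hy => ?_).trans (measure_iUnion_fintype_le μ _)
    exact mem_iUnion.2 ⟨g n y, hy, rfl⟩
  have h2 : ∑ t, μ (A n ∩ {y | g n y = t}) ≤ Fintype.card T * (δ / (Fintype.card T + 1)) := by
    refine (Finset.sum_le_card_nsmul _ _ _ fun t _ => (hlt t).le).trans ?_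
    simp
  have h3 : Fintype.card T * (δ / (Fintype.card T + 1)) < δ := by
    rw [← mul_div_assoc]
    refine ENNReal.div_lt_of_lt_mul ?_
    rw [mul_comm]
    exact (ENNReal.mul_lt_mul_iff_right hδ hδ').2 (ENNReal.lt_add_right (by simp) (by simp))
  exact absurd (hn.trans (h1.trans h2)) (not_le.2 h3)


/-- Parameter `(k, j)` is a candidate for the `k`-th coordinate of a point. -/
abbrev Params := ℕ × ℕ → ℕ → Bool

noncomputable def paramMeasure : Measure Params := infinitePi fun _ => coinMeasure

instance : IsProbabilityMeasure paramMeasure := by unfold paramMeasure; infer_instance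

/-- Points `x` each of whose coordinates `x k` is one of the parameters `y (k, j)`, `j < q k`,
for some `y ∈ C`. -/
def reach (q : ℕ → ℕ) (C : Set Params) : Set (ℕ → ℕ → Bool) :=
  {x | ∃ y ∈ C, ∃ c : ℕ → ℕ, ∀ k, c k < q k ∧ x k = y (k, c k)}

theorem reach_mono (q : ℕ → ℕ) {C C' : Set Params} (h : C ⊆ C') : reach q C ⊆ reach q C' :=
  fun _ ⟨y, hy, c⟩ => ⟨y, h hy, c⟩

/-- The parameters `(k, j)` with `j < q k` are the active ones. The set `D k j` is the region
to which parameter `(k, j)` is confined, and `C n` is the set of configurations that are still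
allowed for the `n`-th function; it has measure bounded below along an ultrafilter. -/
structure Stage where
  q : ℕ → ℕ
  D : ℕ → ℕ → Set (ℕ → Bool)
  C : ℕ → Set Params
  q_pos : ∀ k, 0 < q k
  q_eventually : ∃ K, ∀ k, K ≤ k → q k = 1
  isClosed_D : ∀ k j, IsClosed (D k j)
  nonempty_D : ∀ k j, (D k j).Nonempty
  isOpen_C : ∀ n, IsOpen (C n)
  mem_D : ∀ n, ∀ y ∈ C n, ∀ k j, j < q k → y (k, j) ∈ D k j
  injective_C : ∀ n, ∀ y ∈ C n, ∀ k j j', j < q k → j' < q k → y (k, j) = y (k, j') → j = j'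
  congr_C : ∀ n y y', (∀ k j, j < q k → y' (k, j) = y (k, j)) → y ∈ C n → y' ∈ C n
  large_C : ∃ δ : ENNReal, δ ≠ 0 ∧ ∀ᶠ n in hyperfilter ℕ, δ ≤ paramMeasure (C n)

namespace Stage

/-- The regions of distinct active parameters for the same coordinate are disjoint. -/
def Separated (S : Stage) : Prop :=
  ∀ k j j', j < S.q k → j' < S.q k → ∀ a, a ∈ S.D k j → a ∈ S.D k j' → j = j'

def trivialStage : Stage where
  q _ := 1
  D _ _ := univ
  C _ := univ
  q_pos _ := one_pos
  q_eventually := ⟨0, fun _ _ => rfl⟩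
  isClosed_D _ _ := isClosed_univ
  nonempty_D _ _ := univ_nonempty
  isOpen_C _ := isOpen_univ
  mem_D _ _ _ _ _ _ := mem_univ _
  injective_C _ _ _ _ _ _ _ _ _ := by omega
  congr_C _ _ _ _ _ := mem_univ _
  large_C := ⟨1, one_ne_zero, by simp⟩

theorem separated_trivialStage : trivialStage.Separated := by
  intro k j j' hj hj' _ _ _
  simp only [trivialStage] at hj hj'
  omega

theorem finite_choices (S : Stage) : Finite {c : ℕ → ℕ // ∀ k, c k < S.q k} := by
  obtain ⟨K, hK⟩ := S.q_eventually
  refine Finite.of_injective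
    (β := (k : Fin K) → Fin (S.q k)) (fun c k => ⟨c.1 k, c.2 k⟩) fun c c' h => ?_
  ext k
  by_cases hk : k < K
  · simpa using congrFun h ⟨k, hk⟩
  · have h1 := c.2 k
    have h2 := c'.2 k
    rw [hK k (by omega)] at h1 h2
    omega

theorem exists_decide (S : Stage) (hS : S.Separated)
    (g : ℕ → (ℕ → ℕ → Bool) → Bool) (hg : ∀ n, Continuous (g n)) :
    ∃ S' : Stage, S'.q = S.q ∧ S'.D = S.D ∧ (∀ n, S'.C n ⊆ S.C n) ∧
      ∃ V : (ℕ → ℕ → Bool) → Bool, ∀ n, ∀ x ∈ reach S'.q (S'.C n), g n x = V x := by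
  classical
  have := S.finite_choices
  obtain ⟨δ, hδ, hC⟩ := S.large_C
  obtain ⟨t, ε, hε, ht⟩ := exists_fiber_le paramMeasure (hyperfilter ℕ) hδ hC
    (fun n y (c : {c : ℕ → ℕ // ∀ k, c k < S.q k}) => g n fun k => y (k, c.1 k))
  refine ⟨{ S with
    C := fun n => S.C n ∩ {y | (fun (c : {c : ℕ → ℕ // ∀ k, c k < S.q k}) =>
      g n fun k => y (k, c.1 k)) = t}
    isOpen_C := fun n => (S.isOpen_C n).inter ?_
    mem_D := fun n y hy => S.mem_D n y hy.1
    injective_C := fun n y hy => S.injective_C n y hy.1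
    congr_C := ?_
    large_C := ⟨ε, hε, ht⟩ }, rfl, rfl, fun n => inter_subset_left, ?_⟩
  · refine (isOpen_discrete {t}).preimage ?_
    refine continuous_pi fun c => (hg n).comp ?_
    fun_prop
  · rintro n y y' h ⟨hy, hyt⟩
    refine ⟨S.congr_C n y y' h hy, ?_⟩
    rw [Set.mem_ofPred_eq, ← hyt]
    funext c
    congr 1
    funext k
    exact h k _ (c.2 k)
  · refine ⟨fun x => if h : ∃ c : {c : ℕ → ℕ // ∀ k, c k < S.q k}, ∀ k, x k ∈ S.D k (c.1 k)
      then t h.choose else false, ?_⟩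
    rintro n x ⟨y, ⟨hy, hyt⟩, c, hc⟩
    have hxD : ∀ k, x k ∈ S.D k (c k) := fun k => by
      rw [(hc k).2]; exact S.mem_D n y hy k _ (hc k).1
    have h : ∃ c : {c : ℕ → ℕ // ∀ k, c k < S.q k}, ∀ k, x k ∈ S.D k (c.1 k) :=
      ⟨⟨c, fun k => (hc k).1⟩, hxD⟩
    have heq : h.choose = ⟨c, fun k => (hc k).1⟩ := by
      ext k
      exact hS k _ _ (h.choose.2 k) (hc k).1 _ (h.choose_spec k) (hxD k)
    beta_reduce
    rw [dif_pos h, heq]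
    obtain rfl : x = fun k => y (k, c k) := funext fun k => (hc k).2
    exact congrFun hyt ⟨c, fun k => (hc k).1⟩

theorem exists_duplicate (S : Stage) {k₀ j₀ : ℕ} (hj₀ : j₀ < S.q k₀) :
    ∃ S' : Stage, S'.q = update S.q k₀ (S.q k₀ + 1) ∧
      (∀ k j, j < S.q k → S'.D k j = S.D k j) ∧ S'.D k₀ (S.q k₀) = S.D k₀ j₀ ∧
      ∀ n, reach S'.q (S'.C n) ⊆ reach S.q (S.C n) := by
  obtain ⟨δ, hδ, hC⟩ := S.large_C
  obtain ⟨K, hK⟩ := S.q_eventually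
  have hpp : (k₀, j₀) ≠ (k₀, S.q k₀) := by simp [hj₀.ne]
  have hq : ∀ k j, j < update S.q k₀ (S.q k₀ + 1) k → j < S.q k ∨ (k = k₀ ∧ j = S.q k₀) := by
    intro k j h
    by_cases hk : k = k₀
    · subst hk
      rw [update_self] at h
      omega
    · rw [update_of_ne hk] at h
      exact Or.inl h
  have hq' : ∀ k j, j < S.q k → j < update S.q k₀ (S.q k₀ + 1) k := by
    intro k j h
    by_cases hk : k = k₀
    · subst hk
      rw [update_self]
      omega
    · rwa [update_of_ne hk]
  have hne : ∀ k j, j < S.q k → (k, j) ≠ (k₀, S.q k₀) := by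
    rintro k j h h'
    obtain ⟨rfl, rfl⟩ := Prod.mk.inj h'
    exact lt_irrefl _ h
  refine ⟨{
    q := update S.q k₀ (S.q k₀ + 1)
    D := fun k j => if (k, j) = (k₀, S.q k₀) then S.D k₀ j₀ else S.D k j
    C := fun n => {y | y ∈ S.C n ∧ update y (k₀, j₀) (y (k₀, S.q k₀)) ∈ S.C n ∧
      y (k₀, j₀) ≠ y (k₀, S.q k₀)}
    q_pos := fun k => hq' k 0 (S.q_pos k)
    q_eventually := ⟨max K (k₀ + 1), fun k hk => ?_⟩
    isClosed_D := fun k j => ?_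
    nonempty_D := fun k j => ?_
    isOpen_C := fun n => ?_
    mem_D := ?_
    injective_C := ?_
    congr_C := ?_
    large_C := ⟨δ ^ 2, pow_ne_zero _ hδ, ?_⟩ }, rfl, ?_, if_pos rfl, ?_⟩
  · rw [update_of_ne (by omega)]
    exact hK k (by omega)
  · split_ifs
    exacts [S.isClosed_D _ _, S.isClosed_D _ _]
  · split_ifs
    exacts [S.nonempty_D _ _, S.nonempty_D _ _]
  · refine (S.isOpen_C n).inter (IsOpen.inter ?_ ?_)
    · change IsOpen ((fun y : Params => update y (k₀, j₀) (y (k₀, S.q k₀))) ⁻¹' S.C n)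
      exact (S.isOpen_C n).preimage
        (continuous_id.update (k₀, j₀) (continuous_apply (k₀, S.q k₀)))
    · exact isOpen_ne_fun (continuous_apply _) (continuous_apply _)
  · rintro n y ⟨h1, h2, -⟩ k j hj
    split_ifs with h
    · rw [h]
      simpa using S.mem_D n _ h2 k₀ j₀ hj₀
    · refine S.mem_D n y h1 k j ((hq k j hj).resolve_right ?_)
      rintro ⟨rfl, rfl⟩
      exact h rfl
  · rintro n y ⟨h1, h2, h3⟩
    have key : ∀ j, j < S.q k₀ → y (k₀, j) ≠ y (k₀, S.q k₀) := by
      intro j hj h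
      by_cases hjj : j = j₀
      · subst hjj; exact h3 h
      · refine hjj (S.injective_C n _ h2 k₀ j j₀ hj hj₀ ?_)
        rw [update_self, update_of_ne (by simp [hjj]), h]
    intro k j j' hj hj' h
    rcases hq k j hj with hl | ⟨rfl, rfl⟩ <;> rcases hq _ j' hj' with hl' | ⟨hk, rfl⟩
    · exact S.injective_C n y h1 k j j' hl hl' h
    · subst hk
      exact (key j hl h).elim
    · exact (key j' hl' h.symm).elim
    · rfl
  · rintro n y y' h ⟨h1, h2, h3⟩
    have hp' : y' (k₀, S.q k₀) = y (k₀, S.q k₀) := h _ _ (by simp)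
    refine ⟨S.congr_C n y y' (fun k j hj => h k j (hq' k j hj)) h1,
      S.congr_C n _ _ (fun k j hj => ?_) h2, ?_⟩
    · rw [hp']
      by_cases hkj : (k, j) = (k₀, j₀)
      · rw [hkj, update_self, update_self]
      · rw [update_of_ne hkj, update_of_ne hkj, h k j (hq' k j hj)]
    · rwa [hp', h _ _ (hq' _ _ hj₀)]
  · filter_upwards [hC] with n hn
    refine (pow_le_pow_left₀ bot_le hn 2).trans ?_
    refine sq_measure_le_measure_duplicate coinMeasure (S.isOpen_C n).measurableSet hpp
      fun y a => ⟨?_, ?_⟩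
    · exact S.congr_C n _ _ fun k j hj => (update_of_ne (hne k j hj) _ _).symm
    · exact S.congr_C n _ _ fun k j hj => update_of_ne (hne k j hj) _ _
  · exact fun k j hj => if_neg (hne k j hj)
  · rintro n x ⟨y, ⟨h1, h2, -⟩, c, hc⟩
    by_cases hck : c k₀ = S.q k₀
    · refine ⟨_, h2, update c k₀ j₀, fun k => ?_⟩
      by_cases hk : k = k₀
      · subst hk
        rw [update_self, update_self]
        exact ⟨hj₀, hck ▸ (hc k).2⟩
      · rw [update_of_ne hk, update_of_ne (by simp [hk])]
        exact ⟨(hq k _ (hc k).1).resolve_right fun h => hk h.1, (hc k).2⟩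
    · refine ⟨y, h1, c, fun k => ⟨(hq k _ (hc k).1).resolve_right ?_, (hc k).2⟩⟩
      rintro ⟨rfl, h⟩
      exact hck h

end Stage

/-- The first `L` bits of each of the parameters `(k, j)` with `k, j < L`. -/
def bits (L : ℕ) (y : Params) : Fin L → Fin L → Fin L → Bool := fun k j i => y (k, j) i

theorem measurable_bits (L : ℕ) : Measurable (bits L) := by
  unfold bits
  fun_prop

theorem bits_eq_iff {L : ℕ} {y y' : Params} :
    bits L y = bits L y' ↔ ∀ k < L, ∀ j < L, ∀ i < L, y (k, j) i = y' (k, j) i := by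
  refine ⟨fun h k hk j hj i hi => ?_, fun h => ?_⟩
  · exact congrFun (congrFun (congrFun h ⟨k, hk⟩) ⟨j, hj⟩) ⟨i, hi⟩
  · funext k j i
    exact h k k.2 j j.2 i i.2

theorem exists_bits_subset {C : Set Params} (hC : IsOpen C) {y : Params} (hy : y ∈ C) :
    ∃ L, ∀ y', bits L y' = bits L y → y' ∈ C := by
  by_contra! h
  choose u hu huC using h
  have hlim : Tendsto u atTop (nhds y) := by
    refine tendsto_pi_nhds.2 fun p => tendsto_pi_nhds.2 fun i => ?_
    refine tendsto_const_nhds.congr' ?_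
    filter_upwards [eventually_gt_atTop p.1, eventually_gt_atTop p.2, eventually_gt_atTop i]
      with L h1 h2 h3
    exact (bits_eq_iff.1 (hu L) p.1 h1 p.2 h2 i h3).symm
  obtain ⟨L, hL⟩ := (hlim.eventually (hC.mem_nhds hy)).exists
  exact huC L hL

/-- Among open sets `C n` of measure bounded below, some `C n₀` contains a basic open set
meeting the other `C n` in sets of measure bounded below. -/
theorem exists_bits_large {C : ℕ → Set Params} (hC : ∀ n, IsOpen (C n)) {δ : ENNReal}
    (hδ : δ ≠ 0) (hlarge : ∀ᶠ n in hyperfilter ℕ, δ ≤ paramMeasure (C n)) (m : ℕ) :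
    ∃ n₀ L, m ≤ n₀ ∧ m ≤ L ∧ ∃ y₀, (∀ y, bits L y = bits L y₀ → y ∈ C n₀) ∧
      ∃ ε : ENNReal, ε ≠ 0 ∧
        ∀ᶠ n in hyperfilter ℕ, ε ≤ paramMeasure (C n ∩ {y | bits L y = bits L y₀}) := by
  have hδ' : δ ≠ ⊤ := by
    obtain ⟨n, hn⟩ := hlarge.exists
    exact (hn.trans_lt (measure_lt_top _ _)).ne
  set E : ℕ → Set Params := fun L =>
    {y | ∃ n, m ≤ n ∧ n < L ∧ ∀ y', bits L y' = bits L y → y' ∈ C n}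
  have hmono : Monotone E := by
    rintro L L' hL y ⟨n, h1, h2, h3⟩
    refine ⟨n, h1, h2.trans_le hL, fun y' hy' => h3 y' (bits_eq_iff.2 fun k hk j hj i hi => ?_)⟩
    exact bits_eq_iff.1 hy' k (hk.trans_le hL) j (hj.trans_le hL) i (hi.trans_le hL)
  have hmeas : ∀ L, MeasurableSet (E L) := by
    intro L
    have : E L = bits L ⁻¹' {t | ∃ n, m ≤ n ∧ n < L ∧ ∀ y', bits L y' = t → y' ∈ C n} := rfl
    rw [this]
    exact measurable_bits L (Set.toFinite _).measurableSet
  have hsub : ∀ n, m ≤ n → C n ⊆ ⋃ L, E L := by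
    intro n hn y hy
    obtain ⟨L, hL⟩ := exists_bits_subset (hC n) hy
    refine mem_iUnion.2 ⟨max L (n + 1), n, hn, by omega, fun y' hy' => hL y' ?_⟩
    refine bits_eq_iff.2 fun k hk j hj i hi => bits_eq_iff.1 hy' k ?_ j ?_ i ?_ <;> omega
  have hev : ∀ᶠ n in hyperfilter ℕ, m ≤ n :=
    Nat.hyperfilter_le_atTop (eventually_ge_atTop m)
  have hpos : paramMeasure (⋃ L, E L) ≠ 0 := by
    obtain ⟨n, hn, hmn⟩ := (hlarge.and hev).exists
    intro h0
    exact hδ (le_antisymm (hn.trans ((measure_mono (hsub n hmn)).trans h0.le)) bot_le)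
  have hδ2 : δ / 2 ≠ 0 := by simp [hδ]
  obtain ⟨L, hL⟩ := ((tendsto_order.1 (tendsto_measure_iUnion_atTop (μ := paramMeasure) hmono)).1
    (paramMeasure (⋃ L, E L) - δ / 2)
    (ENNReal.sub_lt_self (measure_ne_top _ _) hpos hδ2)).exists
  have hdiff : paramMeasure ((⋃ L, E L) \ E L) ≤ δ / 2 := by
    rw [measure_sdiff (subset_iUnion E L) (hmeas L).nullMeasurableSet (measure_ne_top _ _)]
    refine tsub_le_iff_left.2 ?_
    rw [← tsub_le_iff_right]
    exact hL.le
  have hlarge' : ∀ᶠ n in hyperfilter ℕ, δ / 2 ≤ paramMeasure (C n ∩ E L) := by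
    filter_upwards [hlarge, hev] with n hn hmn
    have h1 : δ ≤ paramMeasure (C n ∩ E L) + δ / 2 := by
      calc δ ≤ paramMeasure (C n) := hn
        _ ≤ paramMeasure (C n ∩ E L) + paramMeasure (C n \ E L) :=
          measure_le_inter_add_sdiff _ _ _
        _ ≤ _ := by
          gcongr
          exact (measure_mono (sdiff_subset_sdiff_left (hsub n hmn))).trans hdiff
    refine (ENNReal.add_le_add_iff_right (a := δ / 2) (by simp [hδ', ENNReal.div_eq_top])).1 ?_
    rwa [ENNReal.add_halves]
  obtain ⟨t, ε, hε, ht⟩ := exists_fiber_le paramMeasure (hyperfilter ℕ) hδ2 hlarge'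
    (fun _ y => bits L y)
  have hne : ∃ y, y ∈ E L ∧ bits L y = t := by
    obtain ⟨n, hn⟩ := ht.exists
    obtain ⟨y, hy⟩ := nonempty_of_measure_ne_zero
      (fun h0 => hε (le_antisymm (hn.trans h0.le) bot_le))
    exact ⟨y, hy.1.2, hy.2⟩
  obtain ⟨y₀, ⟨n₀, h1, h2, h3⟩, rfl⟩ := hne
  refine ⟨n₀, L, h1, by omega, y₀, h3, ε, hε, ht.mono fun n hn => hn.trans (measure_mono ?_)⟩
  exact inter_subset_inter_left _ inter_subset_left

theorem isClopen_cylinder (L k j : ℕ) (y₀ : Params) :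
    IsClopen {a : ℕ → Bool | k < L → j < L → ∀ i < L, a i = y₀ (k, j) i} := by
  have : {a : ℕ → Bool | k < L → j < L → ∀ i < L, a i = y₀ (k, j) i} =
      ⋂ i : Fin L, (fun a : ℕ → Bool => a i) ⁻¹' {b | k < L → j < L → b = y₀ (k, j) i} := by
    ext a
    simp only [mem_iInter, mem_preimage, Set.mem_ofPred_eq]
    exact ⟨fun h i hk hj => h hk hj i i.2, fun h hk hj i hi => h ⟨i, hi⟩ hk hj⟩
  rw [this]
  exact isClopen_iInter_of_finite fun i => (isClopen_discrete _).preimage (continuous_apply _)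

namespace Stage

theorem exists_shrink (S : Stage) (m : ℕ) :
    ∃ S' : Stage, S'.Separated ∧ S'.q = S.q ∧ (∀ k j, j < S.q k → S'.D k j ⊆ S.D k j) ∧
      (∀ n, S'.C n ⊆ S.C n) ∧
      (∀ k < m, ∀ j < m, ∀ a ∈ S'.D k j, ∀ b ∈ S'.D k j, ∀ i < m, a i = b i) ∧
      ∃ n₀, m ≤ n₀ ∧ ∀ (x : ℕ → ℕ → Bool) (c : ℕ → ℕ),
        (∀ k, c k < S.q k ∧ x k ∈ S'.D k (c k)) → x ∈ reach S.q (S.C n₀) := by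
  classical
  obtain ⟨δ, hδ, hC⟩ := S.large_C
  obtain ⟨n₀, L, hmn, hmL, y₀, hy₀, ε, hε, hlarge⟩ := exists_bits_large S.isOpen_C hδ hC m
  set D : ℕ → ℕ → Set (ℕ → Bool) := fun k j =>
    {a | k < L → j < L → ∀ i < L, a i = y₀ (k, j) i}
  have hy₀D : ∀ k j, y₀ (k, j) ∈ D k j := fun k j _ _ _ _ => rfl
  have hbox : ∀ y : Params, (∀ k j, j < S.q k → y (k, j) ∈ D k j) → y ∈ S.C n₀ := by
    intro y hy
    refine S.congr_C n₀ (fun p => if p.2 < S.q p.1 then y p else y₀ p) y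
      (fun k j hj => (if_pos hj).symm) (hy₀ _ (bits_eq_iff.2 fun k hk j hj i hi => ?_))
    split_ifs with h
    · exact hy k j h hk hj i hi
    · rfl
  have hupd : ∀ k j, ∀ a ∈ D k j, ∀ y : Params, (∀ k j, y (k, j) ∈ D k j) →
      ∀ k' j', update y (k, j) a (k', j') ∈ D k' j' := by
    intro k j a ha y hy k' j'
    by_cases h : (k', j') = (k, j)
    · obtain ⟨rfl, rfl⟩ := Prod.mk.inj h
      rwa [update_self]
    · rw [update_of_ne h]
      exact hy k' j'
  refine ⟨{
    q := S.q
    D := D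
    C := fun n => S.C n ∩ {y | ∀ k j, j < S.q k → y (k, j) ∈ D k j}
    q_pos := S.q_pos
    q_eventually := S.q_eventually
    isClosed_D := fun k j => (isClopen_cylinder L k j y₀).1
    nonempty_D := fun k j => ⟨_, hy₀D k j⟩
    isOpen_C := fun n => (S.isOpen_C n).inter ?_
    mem_D := fun n y hy => hy.2
    injective_C := fun n y hy => S.injective_C n y hy.1
    congr_C := ?_
    large_C := ⟨ε, hε, ?_⟩ }, ?_, rfl, ?_, fun n => inter_subset_left, ?_, n₀, hmn, ?_⟩
  · have : {y : Params | ∀ k j, j < S.q k → y (k, j) ∈ D k j} =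
        ⋂ k : Fin L, ⋂ j : Fin L, {y : Params | (j : ℕ) < S.q k → y (k, j) ∈ D k j} := by
      ext y
      simp only [mem_iInter, Set.mem_ofPred_eq]
      exact ⟨fun h k j => h k j, fun h k j hj hk' hj' => h ⟨k, hk'⟩ ⟨j, hj'⟩ hj hk' hj'⟩
    rw [this]
    refine isOpen_iInter_of_finite fun k => isOpen_iInter_of_finite fun j => ?_
    by_cases hj : (j : ℕ) < S.q k
    · simp only [hj, true_imp_iff]
      exact (isClopen_cylinder L k j y₀).2.preimage (continuous_apply ((k : ℕ), (j : ℕ)))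
    · simp [hj]
  · rintro n y y' h ⟨hy, hyD⟩
    refine ⟨S.congr_C n y y' h hy, fun k j hj => ?_⟩
    rw [h k j hj]
    exact hyD k j hj
  · filter_upwards [hlarge] with n hn
    refine hn.trans (measure_mono (inter_subset_inter_right _ fun y hy => ?_))
    exact fun k j _ hk hj i hi => bits_eq_iff.1 hy k hk j hj i hi
  · intro k j j' hj hj' a ha ha'
    by_contra hne
    refine hne (S.injective_C n₀ (update (update y₀ (k, j) a) (k, j') a)
      (hbox _ fun k' i _ => hupd k j' a ha' _ (hupd k j a ha y₀ hy₀D) k' i) k j j' hj hj' ?_)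
    rw [update_self, update_of_ne (by simp [hne]), update_self]
  · intro k j hj a ha
    have := S.mem_D n₀ _ (hbox _ fun k' i _ => hupd k j a ha y₀ hy₀D k' i) k j hj
    rwa [update_self] at this
  · intro k hk j hj a ha b hb i hi
    rw [ha (by omega) (by omega) i (by omega), hb (by omega) (by omega) i (by omega)]
  · intro x c hx
    refine ⟨fun p => if p.2 = c p.1 then x p.1 else y₀ p, hbox _ fun k j _ => ?_, c,
      fun k => ⟨(hx k).1, by simp⟩⟩
    split_ifs with h
    · simp only at h
      rw [h]
      exact (hx k).2
    · exact hy₀D k j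

end Stage

namespace Stage

/-- One step of the fusion: decide the value of `g` on the current cells, split the parameter
`(k₀, j₀)` in two, and shrink all regions so that their products are handled by one index. -/
theorem exists_next (S : Stage) (hS : S.Separated) (g : ℕ → (ℕ → ℕ → Bool) → Bool)
    (hg : ∀ n, Continuous (g n)) (m : ℕ) {k₀ j₀ : ℕ} (hj₀ : j₀ < S.q k₀) :
    ∃ (S' : Stage) (V : (ℕ → ℕ → Bool) → Bool) (n₀ : ℕ),
      S'.Separated ∧ S'.q = update S.q k₀ (S.q k₀ + 1) ∧
      (∀ k j, j < S.q k → S'.D k j ⊆ S.D k j) ∧ S'.D k₀ (S.q k₀) ⊆ S.D k₀ j₀ ∧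
      (∀ n, reach S'.q (S'.C n) ⊆ reach S.q (S.C n)) ∧
      (∀ n, ∀ x ∈ reach S'.q (S'.C n), g n x = V x) ∧
      (∀ k < m, ∀ j < m, ∀ a ∈ S'.D k j, ∀ b ∈ S'.D k j, ∀ i < m, a i = b i) ∧
      m ≤ n₀ ∧ ∀ (x : ℕ → ℕ → Bool) (c : ℕ → ℕ),
        (∀ k, c k < S'.q k ∧ x k ∈ S'.D k (c k)) → x ∈ reach S.q (S.C n₀) := by
  obtain ⟨S₁, hq₁, hD₁, hC₁, V, hV⟩ := S.exists_decide hS g hg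
  rw [← hq₁] at hj₀
  obtain ⟨S₂, hq₂, hD₂, hD₂', hC₂⟩ := S₁.exists_duplicate hj₀
  obtain ⟨S₃, hsep, hq₃, hD₃, hC₃, hsmall, n₀, hmn, hn₀⟩ := S₂.exists_shrink m
  have h₃₂ : ∀ n, reach S₃.q (S₃.C n) ⊆ reach S₂.q (S₂.C n) := fun n => by
    rw [hq₃]; exact reach_mono _ (hC₃ n)
  have h₁ : ∀ n, reach S₁.q (S₁.C n) ⊆ reach S.q (S.C n) := fun n => by
    rw [hq₁]; exact reach_mono _ (hC₁ n)
  have hlt : ∀ k j, j < S.q k → j < S₂.q k := by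
    intro k j hj
    rw [hq₂, hq₁]
    by_cases hk : k = k₀
    · subst hk
      rw [update_self]
      omega
    · rwa [update_of_ne hk]
  refine ⟨S₃, V, n₀, hsep, by rw [hq₃, hq₂, hq₁], fun k j hj => ?_, ?_,
    fun n => (h₃₂ n).trans ((hC₂ n).trans (h₁ n)), fun n x hx => hV n x (hC₂ n (h₃₂ n hx)),
    hsmall, hmn, fun x c hx => h₁ _ (hC₂ _ (hn₀ x c fun k => ?_))⟩
  · rw [← hD₁, ← hD₂ k j (by rwa [hq₁])]
    exact hD₃ k j (hlt k j hj)
  · rw [← hD₁, ← hD₂', ← hq₁]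
    exact hD₃ k₀ _ (by simp [hq₂])
  · rw [← hq₃]
    exact hx k

end Stage

/-- An enumeration of `ℕ × ℕ` taking every value infinitely often. -/
def schedule (m : ℕ) : ℕ × ℕ := (Nat.unpair m).2.unpair

theorem exists_schedule_eq (k j M : ℕ) : ∃ m, M ≤ m ∧ schedule m = (k, j) :=
  ⟨Nat.pair M (Nat.pair k j), Nat.left_le_pair _ _, by simp [schedule]⟩

theorem exists_fusion_sequence (f : ℕ → (ℕ → ℕ → Bool) → ℕ → Bool) (hf : ∀ n, Continuous (f n)) :
    ∃ (S : ℕ → Stage) (u : ℕ → ℕ) (V : ℕ → (ℕ → ℕ → Bool) → Bool),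
      (∀ m, (S m).Separated) ∧ (∀ m, m ≤ u m) ∧
      (∀ m k, (S m).q k ≤ (S (m + 1)).q k) ∧
      (∀ m k j, j < (S m).q k → (S (m + 1)).D k j ⊆ (S m).D k j) ∧
      (∀ m k j, j < (S (m + 1)).q k → ∃ j' < (S m).q k, (S (m + 1)).D k j ⊆ (S m).D k j') ∧
      (∀ m k j, schedule m = (k, j) → (S m).q k < (S (m + 1)).q k ∧
        (j < (S m).q k → (S (m + 1)).D k ((S m).q k) ⊆ (S m).D k j)) ∧
      (∀ m n, reach (S (m + 1)).q ((S (m + 1)).C n) ⊆ reach (S m).q ((S m).C n)) ∧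
      (∀ m n, ∀ x ∈ reach (S (m + 1)).q ((S (m + 1)).C n), f n x m = V m x) ∧
      (∀ m, ∀ k < m, ∀ j < m, ∀ a ∈ (S (m + 1)).D k j, ∀ b ∈ (S (m + 1)).D k j,
        ∀ i < m, a i = b i) ∧
      ∀ m (x : ℕ → ℕ → Bool) (c : ℕ → ℕ),
        (∀ k, c k < (S (m + 1)).q k ∧ x k ∈ (S (m + 1)).D k (c k)) →
          x ∈ reach (S m).q ((S m).C (u m)) := by
  have hchoice : ∀ (S : Stage) (m : ℕ), ∃ j₀ < S.q (schedule m).1,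
      (schedule m).2 < S.q (schedule m).1 → j₀ = (schedule m).2 := by
    intro S m
    by_cases h : (schedule m).2 < S.q (schedule m).1
    · exact ⟨_, h, fun _ => rfl⟩
    · exact ⟨0, S.q_pos _, fun h' => (h h').elim⟩
  choose job hjob hjob' using hchoice
  have hg : ∀ m n, Continuous fun x => f n x m := fun m n => (continuous_apply m).comp (hf n)
  choose next V u hsep hq hD hDnew hreach hV hsmall hu hcell using
    fun (S : {S : Stage // S.Separated}) (m : ℕ) =>
      S.1.exists_next S.2 (fun n x => f n x m) (hg m) m (hjob S.1 m)
  let T : ℕ → {S : Stage // S.Separated} := fun m =>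
    Nat.rec ⟨Stage.trivialStage, Stage.separated_trivialStage⟩
      (fun m S => ⟨next S m, hsep S m⟩) m
  have hT : ∀ m, (T (m + 1)).1 = next (T m) m := fun m => rfl
  have hqself : ∀ m, (T (m + 1)).1.q (schedule m).1 = (T m).1.q (schedule m).1 + 1 := fun m => by
    rw [hT, hq, update_self]
  have hqne : ∀ m k, k ≠ (schedule m).1 → (T (m + 1)).1.q k = (T m).1.q k := fun m k hk => by
    rw [hT, hq, update_of_ne hk]
  refine ⟨fun m => (T m).1, fun m => u (T m) m, fun m => V (T m) m, fun m => (T m).2,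
    fun m => hu (T m) m, fun m k => ?_, fun m => hD (T m) m, fun m k j hj => ?_,
    fun m k j hs => ?_, fun m => hreach (T m) m, fun m => hV (T m) m, fun m => hsmall (T m) m,
    fun m => hcell (T m) m⟩
  · by_cases hk : k = (schedule m).1
    · rw [hk]
      exact (Nat.le_succ _).trans (hqself m).ge
    · exact (hqne m k hk).ge
  · by_cases hj' : j < (T m).1.q k
    · exact ⟨j, hj', hD (T m) m k j hj'⟩
    · by_cases hk : k = (schedule m).1
      · subst hk
        rw [hqself] at hj
        obtain rfl : j = (T m).1.q (schedule m).1 := by omega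
        exact ⟨_, hjob _ m, hDnew (T m) m⟩
      · rw [hqne m k hk] at hj
        exact (hj' hj).elim
  · obtain ⟨rfl, rfl⟩ : (schedule m).1 = k ∧ (schedule m).2 = j := by simp [hs]
    refine ⟨(Nat.lt_succ_self _).trans_le (hqself m).ge, fun hj => ?_⟩
    have := hDnew (T m) m
    rwa [hjob' _ m hj] at this

end PerfectProduct

theorem stmt10 (f : ℕ → (ℕ → (ℕ → Bool)) → (ℕ → Bool)) (hf : ∀ n, Continuous (f n)) :
    ∃ φ : ℕ → ℕ, StrictMono φ ∧
      ∃ P : ℕ → Set (ℕ → Bool),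
        (∀ k, (P k).Nonempty ∧ Perfect (P k)) ∧
        ∀ x ∈ Set.pi Set.univ P, ∃ y : ℕ → Bool,
          Tendsto (fun i => f (φ i) x) atTop (nhds y) := by
  obtain ⟨S, u, V, hsep, hu, hq, hD, hparent, hsplit, hreach, hV, hsmall, hcell⟩ :=
    PerfectProduct.exists_fusion_sequence f hf
  have hqmono : ∀ k, Monotone fun m => (S m).q k := fun k => monotone_nat_of_le_succ fun m => hq m k
  have hactive : ∀ k j, ∃ M, ∀ m, M ≤ m → j < (S m).q k := by
    intro k j
    induction j with
    | zero => exact ⟨0, fun m _ => (S m).q_pos k⟩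
    | succ j ih =>
      obtain ⟨M, hM⟩ := ih
      obtain ⟨m, hm, hs⟩ := PerfectProduct.exists_schedule_eq k 0 M
      refine ⟨m + 1, fun m' hm' => ?_⟩
      have h1 := hM m hm
      have h2 := (hsplit m k 0 hs).1
      have h3 : (S (m + 1)).q k ≤ (S m').q k := hqmono k hm'
      omega
  have hDanti : ∀ k j m m', m ≤ m' → j < (S m).q k → (S m').D k j ⊆ (S m).D k j := by
    intro k j m m' hm hj
    induction m', hm using Nat.le_induction with
    | base => exact subset_rfl
    | succ m' hm ih => exact (hD m' k j (hj.trans_le (hqmono k hm))).trans ih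
  have hpoint : ∀ k j, ∃ z, ∀ m, j < (S m).q k → z ∈ (S m).D k j := by
    intro k j
    obtain ⟨M, hM⟩ := hactive k j
    obtain ⟨z, hz⟩ := IsCompact.nonempty_iInter_of_sequence_nonempty_isCompact_isClosed
      (fun i => (S (M + i)).D k j) (fun i => hD _ k j (hM _ (Nat.le_add_right M i)))
      (fun i => (S (M + i)).nonempty_D k j) ((S (M + 0)).isClosed_D k j).isCompact
      (fun i => (S (M + i)).isClosed_D k j)
    refine ⟨z, fun m hm => hDanti k j m (M + m) (by omega) hm ?_⟩
    exact Set.mem_iInter.1 hz m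
  choose z hz using hpoint
  have hinj : ∀ k j j', z k j = z k j' → j = j' := by
    intro k j j' h
    obtain ⟨M, hM⟩ := hactive k j
    obtain ⟨M', hM'⟩ := hactive k j'
    have hj := hM (max M M') (by omega)
    have hj' := hM' (max M M') (by omega)
    exact hsep (max M M') k j j' hj hj' _ (hz k j _ hj) (h ▸ hz k j' _ hj')
  have hcover : ∀ k m m', m ≤ m' → ∀ j < (S m').q k, ∃ j' < (S m).q k,
      (S m').D k j ⊆ (S m).D k j' := by
    intro k m m' hm
    induction m', hm using Nat.le_induction with
    | base => exact fun j hj => ⟨j, hj, subset_rfl⟩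
    | succ m' hm ih =>
      intro j hj
      obtain ⟨j', hj', h'⟩ := hparent m' k j hj
      obtain ⟨j'', hj'', h''⟩ := ih j' hj'
      exact ⟨j'', hj'', h'.trans h''⟩
  have hclosure : ∀ k m, closure (Set.range (z k)) ⊆
      ⋃ j ∈ Finset.range ((S m).q k), (S m).D k j := by
    intro k m
    refine closure_minimal ?_
      (isClosed_biUnion_finset fun j _ => (S m).isClosed_D k j)
    rintro _ ⟨j, rfl⟩
    obtain ⟨M, hM⟩ := hactive k j
    have hj := hM (max m M) (by omega)
    obtain ⟨j', hj', h⟩ := hcover k m (max m M) (by omega) j hj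
    exact Set.mem_biUnion (Finset.mem_coe.2 (Finset.mem_range.2 hj')) (h (hz k j _ hj))
  have hpreperfect : ∀ k, Preperfect (Set.range (z k)) := by
    refine fun k => preperfect_iff_nhds.2 ?_
    rintro _ ⟨j, rfl⟩ U hU
    obtain ⟨M, hM⟩ := hactive k j
    have hnear : ∀ L, ∃ j', j' ≠ j ∧ ∀ i < L, z k j' i = z k j i := by
      intro L
      obtain ⟨m, hm, hs⟩ := PerfectProduct.exists_schedule_eq k j (M + L + k + j + 2)
      obtain ⟨m, rfl⟩ : ∃ n, m = n + 1 := ⟨m - 1, by omega⟩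
      have hj := hM (m + 1) (by omega)
      obtain ⟨h1, h2⟩ := hsplit _ k j hs
      refine ⟨(S (m + 1)).q k, hj.ne', fun i hi => ?_⟩
      exact hsmall m k (by omega) j (by omega) _ (h2 hj (hz k _ _ h1)) _ (hz k j _ hj) i (by omega)
    choose w hw hwz using hnear
    have hlim : Tendsto (fun L => z k (w L)) atTop (nhds (z k j)) := by
      refine tendsto_pi_nhds.2 fun i => tendsto_const_nhds.congr' ?_
      filter_upwards [eventually_gt_atTop i] with L hL
      exact (hwz L i hL).symm
    obtain ⟨L, hL⟩ := (hlim.eventually hU).exists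
    exact ⟨_, ⟨hL, w L, rfl⟩, fun h => hw L (hinj k _ _ h)⟩
  obtain ⟨ψ, hψ, hφ⟩ := strictMono_subseq_of_id_le hu
  refine ⟨u ∘ ψ, hφ, fun k => closure (Set.range (z k)),
    fun k => ⟨(Set.range_nonempty _).closure, (hpreperfect k).perfect_closure⟩,
    fun x hx => ⟨fun i => V i x, tendsto_pi_nhds.2 fun i => tendsto_const_nhds.congr' ?_⟩⟩
  have hmem : ∀ m, x ∈ PerfectProduct.reach (S m).q ((S m).C (u m)) := by
    intro m
    have hc : ∀ k, ∃ j, j < (S (m + 1)).q k ∧ x k ∈ (S (m + 1)).D k j := fun k => by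
      simpa using hclosure k (m + 1) (hx k trivial)
    choose c hc using hc
    exact hcell m x c hc
  have hreach' : ∀ n m m', m ≤ m' →
      PerfectProduct.reach (S m').q ((S m').C n) ⊆ PerfectProduct.reach (S m).q ((S m).C n) := by
    intro n m m' hm
    induction m', hm using Nat.le_induction with
    | base => exact subset_rfl
    | succ m' hm ih => exact (hreach m' n).trans ih
  filter_upwards [eventually_gt_atTop i] with l hl
  have hil : i + 1 ≤ ψ l := hl.trans_le (hψ.id_le l)
  exact (hV i _ x (hreach' _ _ _ hil (hmem (ψ l)))).symm
end

section
/- Let f_n : (2^ω)^ω → 2^ω be functions with the Baire property (preimages of open sets have the Baire property). Then there exist an infinite set N ⊆ ω and nonempty perfect sets P_k ⊆ 2^ω such that (f_n)_{n∈N} converges pointwise on ∏_{k∈ω} P_k. -/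
open Filter

/-- a set has the Baire property if it is an open set modulo a meager set -/
def HasBaireProperty {X : Type*} [TopologicalSpace X] (S : Set X) : Prop :=
  ∃ U m : Set X, IsOpen U ∧ IsMeagre m ∧ S = symmDiff U m

/-- A compact Hausdorff right topological semigroup has a minimal idempotent. -/
theorem exists_minimal_idempotent {S : Type*} [Nonempty S] [Semigroup S] [TopologicalSpace S]
    [CompactSpace S] [T2Space S] (hc : ∀ r : S, Continuous (· * r)) :
    ∃ p : S, p * p = p ∧ ∀ e : S, e * e = e → e * p = e → p * e = e → e = p := by
  let I : Set (Set S) := {L | IsClosed L ∧ L.Nonempty ∧ ∀ s : S, ∀ x ∈ L, s * x ∈ L}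
  obtain ⟨L, hL⟩ : ∃ L, Minimal (· ∈ I) L := by
    refine zorn_superset _ fun c hcs hchain => ?_
    refine ⟨⋂₀ c, ⟨isClosed_sInter fun t ht => (hcs ht).1, ?_, fun s x hx t ht =>
      (hcs ht).2.2 s x (hx t ht)⟩, fun s hs => Set.sInter_subset_of_mem hs⟩
    obtain rfl | hne := c.eq_empty_or_nonempty
    · simp
    rw [Set.sInter_eq_iInter]
    have := hne.coe_sort
    exact IsCompact.nonempty_iInter_of_directed_nonempty_isCompact_isClosed _
      (DirectedOn.directed_val (IsChain.directedOn hchain.symm)) (fun i => (hcs i.2).2.1)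
      (fun i => (hcs i.2).1.isCompact) (fun i => (hcs i.2).1)
  obtain ⟨hLc, hLn, hLi⟩ := hL.prop
  obtain ⟨p, hpL, hp⟩ := exists_idempotent_in_compact_subsemigroup hc L hLn hLc.isCompact
    fun x _ y hy => hLi x y hy
  refine ⟨p, hp, fun e he hep hpe => ?_⟩
  have heL : e ∈ L := hep ▸ hLi e p hpL
  have hLe : (· * e) '' L = L := by
    refine hL.eq_of_subset ⟨(hc e).isClosedMap _ hLc, hLn.image _, ?_⟩ ?_
    · rintro s _ ⟨x, hx, rfl⟩
      exact ⟨s * x, hLi s x hx, mul_assoc _ _ _⟩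
    · rintro _ ⟨x, -, rfl⟩
      exact hLi x e heL
  obtain ⟨x, -, hx⟩ : p ∈ (· * e) '' L := hLe.symm ▸ hpL
  have hx : x * e = p := hx
  rw [← hpe, ← hx, mul_assoc, he]

section UltrafilterSemigroup

attribute [local instance] Ultrafilter.semigroup

theorem Ultrafilter.map_mul_of_mulHom {M N : Type*} [Semigroup M] [Semigroup N] (g : M → N)
    (hg : ∀ x y, g (x * y) = g x * g y) (U V : Ultrafilter M) :
    (U * V).map g = U.map g * V.map g := by
  refine Ultrafilter.coe_inj.mp <| Filter.ext' fun P => ?_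
  rw [Ultrafilter.eventually_mul]
  simp only [Ultrafilter.coe_map, Filter.eventually_map]
  rw [Ultrafilter.eventually_mul]
  simp only [hg]

/-- Replace every occurrence of the variable `none` in a variable word by the letter `a`. -/
def substLetter {A : Type*} (a : A) : FreeMonoid (Option A) →* FreeMonoid A :=
  FreeMonoid.map fun o => o.getD a

/-- There is an idempotent ultrafilter on words which is the image, under every substitution, of
one ultrafilter on variable words. -/
theorem exists_ultrafilter_substLetter (A : Type*) :
    ∃ (p : Ultrafilter (FreeMonoid A)) (q : Ultrafilter (FreeMonoid (Option A))),
      p * p = p ∧ (∀ᶠ w : FreeMonoid (Option A) in q, none ∈ w.toList) ∧ ∀ a, q.map (substLetter a) = p := by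
  obtain ⟨p, hp, hmin⟩ := exists_minimal_idempotent (S := Ultrafilter (FreeMonoid A))
    Ultrafilter.continuous_mul_left
  let p' : Ultrafilter (FreeMonoid (Option A)) := p.map (FreeMonoid.map some)
  have hp' : p' * p' = p' := by
    rw [← Ultrafilter.map_mul_of_mulHom _ (map_mul _), hp]
  let V : Set (FreeMonoid (Option A)) := {w | none ∈ FreeMonoid.toList w}
  let J : Set (Ultrafilter (FreeMonoid (Option A))) := {r | V ∈ r}
  have hJr : ∀ r ∈ J, ∀ s, r * s ∈ J := fun r (hr : ∀ᶠ w in r, w ∈ V) s => by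
    change ∀ᶠ w in ↑(r * s), w ∈ V
    rw [Ultrafilter.eventually_mul]
    filter_upwards [hr] with w hw
    exact Eventually.of_forall fun v => List.mem_append_left _ hw
  have hJl : ∀ r ∈ J, ∀ s, s * r ∈ J := fun r (hr : ∀ᶠ w in r, w ∈ V) s => by
    change ∀ᶠ w in ↑(s * r), w ∈ V
    rw [Ultrafilter.eventually_mul]
    refine Eventually.of_forall fun v => ?_
    filter_upwards [hr] with w hw
    exact List.mem_append_right _ hw
  have hJc : IsClosed J := ultrafilter_isClosed_basic V
  have hJn : J.Nonempty := ⟨pure (FreeMonoid.of none), by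
    exact Ultrafilter.mem_pure.2 (List.mem_singleton.2 rfl)⟩
  obtain ⟨_, ⟨r, hr, rfl⟩, he⟩ := exists_idempotent_in_compact_subsemigroup
    Ultrafilter.continuous_mul_left ((· * p') '' J) (hJn.image _)
    (hJc.isCompact.image (Ultrafilter.continuous_mul_left p')) (by
      rintro _ ⟨x, hx, rfl⟩ _ ⟨y, hy, rfl⟩
      exact ⟨x * p' * y, hJl _ hy _, by simp only [mul_assoc]⟩)
  have he : r * p' * (r * p') = r * p' := he
  set e := r * p' with he_def
  have hep : e * p' = e := by rw [he_def, mul_assoc, hp']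
  have hq : p' * e * (p' * e) = p' * e := by
    rw [mul_assoc, ← mul_assoc e, hep, he]
  have hqJ : p' * e ∈ J := hJl _ (hJr _ hr _) _
  refine ⟨p, p' * e, hp, hqJ, fun a => ?_⟩
  have hpa : p'.map (substLetter a) = p := by
    rw [Ultrafilter.map_map]
    convert Ultrafilter.map_id p using 2
    funext w
    simp only [substLetter, Function.comp_apply, FreeMonoid.map_map]
    exact DFunLike.congr_fun FreeMonoid.map_id w
  have hmap := Ultrafilter.map_mul_of_mulHom _ (map_mul (substLetter a))
  apply hmin
  · rw [← hmap, hq]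
  · conv_lhs => rw [← hpa]
    rw [← hmap, mul_assoc, hep]
  · conv_lhs => rw [← hpa]
    rw [← hmap, ← mul_assoc, hp']

/-- The word obtained by substituting the letters `a 0, …, a (i - 1)` in the variable words
`w 0, …, w (i - 1)` and concatenating. -/
def substProd {A : Type*} (w : ℕ → FreeMonoid (Option A)) (a : ℕ → A) : ℕ → FreeMonoid A
  | 0 => 1
  | i + 1 => substProd w a i * substLetter (a i) (w i)

theorem substProd_congr {A : Type*} {w w' : ℕ → FreeMonoid (Option A)} {a a' : ℕ → A} {i : ℕ}
    (hw : ∀ l < i, w l = w' l) (ha : ∀ l < i, a l = a' l) :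
    substProd w a i = substProd w' a' i := by
  induction i with
  | zero => rfl
  | succ i ih =>
    simp only [substProd]
    rw [ih (fun l hl => hw l (by omega)) (fun l hl => ha l (by omega)), hw i (by omega),
      ha i (by omega)]

/-- A form of Carlson's theorem: along the products of suitable variable words `w i`, with
substitutions from finite alphabets `F i`, each of countably many colourings eventually stabilizes. -/
theorem exists_substProd_stable {A : Type*} (c : ℕ → FreeMonoid A → Bool) (F : ℕ → Set A)
    (hF : ∀ i, (F i).Finite) :
    ∃ w : ℕ → FreeMonoid (Option A), (∀ i, none ∈ FreeMonoid.toList (w i)) ∧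
      ∀ (j : ℕ) (a : ℕ → A), (∀ i, a i ∈ F i) →
        ∃ v : Bool, ∀ i, j < i → c j (substProd w a i) = v := by
  obtain ⟨p, q, hp, hqV, hq⟩ := exists_ultrafilter_substLetter A
  have hlim : ∀ j u, ∃ v : Bool, ∀ᶠ x in p, c j (u * x) = v := by
    intro j u
    have : ∀ᶠ x in p, c j (u * x) = true ∨ c j (u * x) = false :=
      Eventually.of_forall fun x => by cases c j (u * x) <;> simp
    rcases Ultrafilter.eventually_or.1 this with h | h
    exacts [⟨_, h⟩, ⟨_, h⟩]
  choose d hd using hlim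
  have hdd : ∀ j u, ∀ᶠ x in p, d j (u * x) = d j u := by
    intro j u
    have h := hd j u
    rw [← hp, Ultrafilter.eventually_mul] at h
    filter_upwards [h] with x hx
    obtain ⟨y, hy, hy'⟩ := (hx.and (hd j (u * x))).exists
    rw [← hy, ← hy', mul_assoc]
  have hstep : ∀ (i : ℕ) (B : Set (FreeMonoid A)), B.Finite →
      ∃ w : FreeMonoid (Option A), none ∈ FreeMonoid.toList w ∧ ∀ u ∈ B, ∀ b ∈ F i, ∀ j ≤ i,
        c j (u * substLetter b w) = d j u ∧ d j (u * substLetter b w) = d j u := by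
    intro i B hB
    have h : ∀ᶠ w in q, ∀ u ∈ B, ∀ b ∈ F i, ∀ j ∈ Set.Iic i,
        c j (u * substLetter b w) = d j u ∧ d j (u * substLetter b w) = d j u := by
      rw [hB.eventually_all]
      intro u _
      rw [(hF i).eventually_all]
      intro b _
      rw [(Set.finite_Iic i).eventually_all]
      intro j _
      have := (hd j u).and (hdd j u)
      rw [← hq b, Ultrafilter.coe_map, Filter.eventually_map] at this
      exact this
    exact (hqV.and h).exists
  choose! g hgV hg using hstep
  have hfin : ∀ (w : ℕ → FreeMonoid (Option A)) i,
      {u | ∃ a : ℕ → A, (∀ l, a l ∈ F l) ∧ substProd w a i = u}.Finite := by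
    intro w i
    induction i with
    | zero => exact (Set.finite_singleton 1).subset (by rintro _ ⟨a, -, rfl⟩; rfl)
    | succ i ih =>
      refine (ih.image2 (fun u b => u * substLetter b (w i)) (hF i)).subset ?_
      rintro _ ⟨a, ha, rfl⟩
      exact ⟨_, ⟨a, ha, rfl⟩, _, ha i, rfl⟩
  obtain ⟨w, hw⟩ : ∃ w : ℕ → FreeMonoid (Option A), ∀ i,
      w i = g i {u | ∃ a : ℕ → A, (∀ l, a l ∈ F l) ∧ substProd w a i = u} := by
    let ext (i : ℕ) (h : ∀ l < i, FreeMonoid (Option A)) (l : ℕ) : FreeMonoid (Option A) :=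
      if hl : l < i then h l hl else 1
    let w : ℕ → FreeMonoid (Option A) := fun i => Nat.strongRec (fun i h =>
      g i {u | ∃ a : ℕ → A, (∀ l, a l ∈ F l) ∧ substProd (ext i h) a i = u}) i
    refine ⟨w, fun i => ?_⟩
    have hwi : w i = g i {u | ∃ a : ℕ → A, (∀ l, a l ∈ F l) ∧
        substProd (ext i fun l _ => w l) a i = u} := by
      simp only [w]
      rw [Nat.strongRec_eq]
    rw [hwi]
    congr 1
    ext u
    refine exists_congr fun a => and_congr_right fun _ => ?_
    rw [substProd_congr (w' := w) (a' := a) (fun l hl => by simp [ext, hl]) fun _ _ => rfl]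
  refine ⟨w, fun i => by rw [hw]; exact hgV i _ (hfin w i), fun j a ha => ?_⟩
  have key : ∀ i, j ≤ i → c j (substProd w a (i + 1)) = d j (substProd w a i) ∧
      d j (substProd w a (i + 1)) = d j (substProd w a i) := by
    intro i hi
    have := hg i _ (hfin w i) _ ⟨a, ha, rfl⟩ (a i) (ha i) j hi
    rwa [← hw i] at this
  have hconst : ∀ i, j ≤ i → d j (substProd w a i) = d j (substProd w a j) := fun i hi =>
    Nat.le_induction rfl (fun n hn ih => (key n hn).2.trans ih) i hi
  refine ⟨d j (substProd w a j), fun i hi => ?_⟩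
  obtain ⟨i, rfl⟩ : ∃ l, i = l + 1 := ⟨i - 1, by omega⟩
  rw [(key i (by omega)).1, hconst i (by omega)]

end UltrafilterSemigroup

theorem continuous_of_finite_dependence {g : (ℕ → Bool) → (ℕ → Bool)}
    (h : ∀ l, ∃ m, ∀ b b' : ℕ → Bool, (∀ i < m, b i = b' i) → g b l = g b' l) : Continuous g := by
  refine continuous_pi fun l => ?_
  obtain ⟨m, hm⟩ := h l
  refine continuous_iff_continuousAt.2 fun b => ?_
  have hb : ∀ᶠ b' in nhds b, ∀ i ∈ Set.Iio m, b' i = b i := by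
    rw [(Set.finite_Iio m).eventually_all]
    intro i _
    exact (continuous_apply i).continuousAt.eventually_mem
      ((isOpen_discrete {b i}).mem_nhds rfl)
  refine tendsto_const_nhds.congr' (f₁ := fun _ => g b l) ?_
  filter_upwards [hb] with b' hb'
  exact hm _ _ fun i hi => (hb' i hi).symm

theorem perfect_range_of_separates {Ψ : (ℕ → Bool) → (ℕ → Bool)} (hΨ : Continuous Ψ) (k : ℕ)
    (hsep : ∀ b b' : ℕ → Bool, ∀ i, k ≤ i → b i ≠ b' i → Ψ b ≠ Ψ b') :
    Perfect (Set.range Ψ) := by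
  refine ⟨(isCompact_range hΨ).isClosed, ?_⟩
  rintro _ ⟨b, rfl⟩
  rw [accPt_iff_nhds]
  intro U hU
  have hlim : Tendsto (fun i => Function.update b i (!b i)) atTop (nhds b) := by
    refine tendsto_pi_nhds.2 fun l => tendsto_const_nhds.congr' ?_
    filter_upwards [eventually_gt_atTop l] with i hi
    rw [Function.update_of_ne hi.ne]
  have hev := ((hΨ.tendsto b).comp hlim).eventually_mem hU
  obtain ⟨i, hi, hki⟩ := (hev.and (eventually_ge_atTop k)).exists
  exact ⟨_, ⟨hi, _, rfl⟩, hsep _ _ i hki (by simp)⟩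

/-- A continuous function to a discrete space depends only on an initial segment of each
coordinate of its argument. -/
theorem exists_level_of_continuous {D : Type*} [TopologicalSpace D] [DiscreteTopology D]
    {g : (ℕ → ℕ → Bool) → D} (hg : Continuous g) :
    ∃ M, ∀ x y : ℕ → ℕ → Bool, (∀ k, ∀ l < M, x k l = y k l) → g x = g y := by
  by_contra! hcon
  let T (M : ℕ) : Set ((ℕ → ℕ → Bool) × (ℕ → ℕ → Bool)) :=
    {z | (∀ k, ∀ l < M, z.1 k l = z.2 k l) ∧ g z.1 ≠ g z.2}
  have hT : ∀ M, IsClosed (T M) := by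
    intro M
    refine IsClosed.inter (s₁ := {z : (ℕ → ℕ → Bool) × (ℕ → ℕ → Bool) | ∀ k, ∀ l < M, z.1 k l = z.2 k l})
      (s₂ := {z : (ℕ → ℕ → Bool) × (ℕ → ℕ → Bool) | g z.1 ≠ g z.2}) ?_ ?_
    · simp only [Set.ofPred_forall]
      refine isClosed_iInter fun k => isClosed_iInter fun l => isClosed_iInter fun _ => ?_
      exact isClosed_eq (by fun_prop) (by fun_prop)
    · exact (isClosed_discrete {p : D × D | p.1 ≠ p.2}).preimage
        ((hg.comp continuous_fst).prodMk (hg.comp continuous_snd))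
  obtain ⟨z, hz⟩ := IsCompact.nonempty_iInter_of_sequence_nonempty_isCompact_isClosed T
    (fun M z hz => ⟨fun k l hl => hz.1 k l (by omega), hz.2⟩)
    (fun M => by obtain ⟨x, y, h, hne⟩ := hcon M; exact ⟨(x, y), h, hne⟩)
    (hT 0).isCompact hT
  rw [Set.mem_iInter] at hz
  refine (hz 0).2 (congrArg g ?_)
  funext k l
  exact (hz (l + 1)).1 k l (Nat.lt_succ_self l)

/-- The points of the product agreeing with `z` on the first `L` entries of the first `L`
coordinates. -/
def box (z : ℕ → ℕ → Bool) (L : ℕ) : Set (ℕ → ℕ → Bool) := {y | ∀ k < L, ∀ l < L, y k l = z k l}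

theorem isOpen_box (z : ℕ → ℕ → Bool) (L : ℕ) : IsOpen (box z L) := by
  have : box z L = ⋂ k ∈ Set.Iio L, ⋂ l ∈ Set.Iio L, {y | y k l = z k l} := by
    ext y; simp [box]
  rw [this]
  refine (Set.finite_Iio L).isOpen_biInter fun k _ => (Set.finite_Iio L).isOpen_biInter fun l _ => ?_
  have hc : Continuous fun y : ℕ → ℕ → Bool => y k l := by fun_prop
  exact (isOpen_discrete {z k l}).preimage hc

theorem exists_box_subset {G : Set (ℕ → ℕ → Bool)} (hG : IsOpen G) {z : ℕ → ℕ → Bool}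
    (hz : z ∈ G) (L₀ : ℕ) : ∃ L, L₀ ≤ L ∧ box z L ⊆ G := by
  by_contra! hcon
  choose y hy hyG using fun L : ℕ => Set.not_subset.1 (hcon (L₀ + L) (Nat.le_add_right _ _))
  have hlim : Tendsto y atTop (nhds z) := by
    refine tendsto_pi_nhds.2 fun k => tendsto_pi_nhds.2 fun l => tendsto_const_nhds.congr' ?_
    filter_upwards [eventually_gt_atTop k, eventually_gt_atTop l] with L hk hl
    exact (hy L k (by omega) l (by omega)).symm
  obtain ⟨L, hL⟩ := (hlim.eventually_mem (hG.mem_nhds hz)).exists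
  exact hyG L hL

/-- `z k` factors through the entries of its argument with index in `[k, j)`. -/
def DependsOnWindow (j : ℕ) (z : ℕ → (ℕ → Bool) → (ℕ → Bool)) : Prop :=
  ∀ k b b', (∀ i, k ≤ i → i < j → b i = b' i) → z k b = z k b'

theorem exists_refinement_point {G : Set (ℕ → ℕ → Bool)} (hG : IsOpen G) (hd : Dense G) {j : ℕ}
    {z : ℕ → (ℕ → Bool) → (ℕ → Bool)} (hz : DependsOnWindow j z) (L : ℕ) (x : ℕ → ℕ → Bool) :
    ∃ (z' : ℕ → (ℕ → Bool) → (ℕ → Bool)) (L' : ℕ), DependsOnWindow j z' ∧ L ≤ L' ∧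
      (∀ k < L, ∀ l < L, ∀ b, z' k b l = z k b l) ∧ box (fun k => z' k (x k)) L' ⊆ G := by
  obtain ⟨w, hw, hwG⟩ := hd.inter_open_nonempty (box (fun k => z k (x k)) L) (isOpen_box _ _)
    ⟨fun k => z k (x k), fun _ _ _ _ => rfl⟩
  obtain ⟨L', hL, hbox⟩ := exists_box_subset hG hwG L
  classical
  refine ⟨fun k b => if ∀ i, k ≤ i → i < j → b i = x k i then w k else z k b, L', ?_, hL, ?_, ?_⟩
  · intro k b b' hb
    have : (∀ i, k ≤ i → i < j → b i = x k i) ↔ ∀ i, k ≤ i → i < j → b' i = x k i :=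
      forall_congr' fun i => forall_congr' fun h1 => forall_congr' fun h2 => by rw [hb i h1 h2]
    simp only [this, hz k b b' hb]
  · intro k hk l hl b
    dsimp only
    split_ifs with h
    · rw [hw k hk l hl, hz k b (x k) h]
    · rfl
  · simpa using hbox

theorem exists_refinement {G : Set (ℕ → ℕ → Bool)} (hG : IsOpen G) (hd : Dense G) {j : ℕ}
    {z : ℕ → (ℕ → Bool) → (ℕ → Bool)} (hz : DependsOnWindow j z) (L : ℕ) :
    ∃ (z' : ℕ → (ℕ → Bool) → (ℕ → Bool)) (L' : ℕ), DependsOnWindow j z' ∧ L ≤ L' ∧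
      (∀ k < L, ∀ l < L, ∀ b, z' k b l = z k b l) ∧
      ∀ x : ℕ → ℕ → Bool, box (fun k => z' k (x k)) L' ⊆ G := by
  have hfin : ∀ R : Set (ℕ → ℕ → Bool), R.Finite →
      ∃ (z' : ℕ → (ℕ → Bool) → (ℕ → Bool)) (L' : ℕ), DependsOnWindow j z' ∧ L ≤ L' ∧
        (∀ k < L, ∀ l < L, ∀ b, z' k b l = z k b l) ∧
        ∀ x ∈ R, box (fun k => z' k (x k)) L' ⊆ G := by
    intro R hR
    induction R, hR using Set.Finite.induction_on with
    | empty => exact ⟨z, L, hz, le_rfl, fun _ _ _ _ _ => rfl, by simp⟩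
    | @insert x R _ _ ih =>
      obtain ⟨z₁, L₁, hz₁, hL₁, h₁, hR₁⟩ := ih
      obtain ⟨z₂, L₂, hz₂, hL₂, h₂, hx⟩ := exists_refinement_point hG hd hz₁ L₁ x
      refine ⟨z₂, L₂, hz₂, hL₁.trans hL₂, fun k hk l hl b => ?_, ?_⟩
      · rw [h₂ k (by omega) l (by omega), h₁ k hk l hl]
      · rintro y (rfl | hy)
        · exact hx
        · intro u hu
          refine hR₁ y hy fun k hk l hl => ?_
          exact (hu k (by omega) l (by omega)).trans (h₂ k hk l hl (y k))
  let ext (g : Fin j → Fin j → Bool) (k i : ℕ) : Bool :=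
    if h : k < j ∧ i < j then g ⟨k, h.1⟩ ⟨i, h.2⟩ else false
  obtain ⟨z', L', hz', hL, h, hR⟩ := hfin (Set.range ext) (Set.finite_range ext)
  refine ⟨z', L', hz', hL, h, fun x => ?_⟩
  have hx : (fun k => z' k (x k)) = fun k => z' k (ext (fun k i => x k i) k) := by
    funext k
    refine hz' _ _ _ fun i h1 h2 => ?_
    simp [ext, h2, lt_of_le_of_lt h1 h2]
  rw [hx]
  exact hR _ (Set.mem_range_self (f := ext) fun k i => x k i)

theorem exists_fusion_step {G : Set (ℕ → ℕ → Bool)} (hG : IsOpen G) (hd : Dense G) {j : ℕ}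
    {z : ℕ → (ℕ → Bool) → (ℕ → Bool)} (hz : DependsOnWindow j z) (L : ℕ) :
    ∃ (z' : ℕ → (ℕ → Bool) → (ℕ → Bool)) (L' : ℕ), DependsOnWindow (j + 1) z' ∧
      L < L' ∧ j < L' ∧ (∀ k < L, ∀ l < L, ∀ b, z' k b l = z k b l) ∧
      (∀ x : ℕ → ℕ → Bool, box (fun k => z' k (x k)) L' ⊆ G) ∧
      ∃ l < L', ∀ k ≤ j, ∀ b, z' k b l = b j := by
  obtain ⟨z₁, L₁, hz₁, hL₁, h₁, hG₁⟩ := exists_refinement hG hd hz L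
  let m := max L₁ j
  refine ⟨fun k b l => if l = m ∧ k ≤ j then b j else z₁ k b l, m + 1, ?_, by omega, by omega,
    ?_, ?_, m, by omega, ?_⟩
  · intro k b b' hb
    funext l
    dsimp only
    rw [hz₁ k b b' fun i h1 h2 => hb i h1 (by omega)]
    split_ifs with h
    · exact hb j h.2 (by omega)
    · rfl
  · intro k hk l hl b
    rw [← h₁ k hk l hl]
    exact if_neg (by omega)
  · intro x u hu
    refine hG₁ x fun k hk l hl => ?_
    rw [hu k (by omega) l (by omega)]
    exact if_neg (by omega)
  · intro k hk b
    exact if_pos ⟨rfl, hk⟩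

/-- Countably many dense open subsets of the product contain a common product of perfect sets,
parametrized coordinatewise. -/
theorem exists_continuous_maps_into_dense_open {G : ℕ → Set (ℕ → ℕ → Bool)}
    (hG : ∀ j, IsOpen (G j)) (hd : ∀ j, Dense (G j)) :
    ∃ φ : ℕ → (ℕ → Bool) → (ℕ → Bool), (∀ k, Continuous (φ k)) ∧
      (∀ k b b' i, k ≤ i → b i ≠ b' i → φ k b ≠ φ k b') ∧
      ∀ (x : ℕ → ℕ → Bool) (j : ℕ), (fun k => φ k (x k)) ∈ G j := by
  let State (j : ℕ) := {s : (ℕ → (ℕ → Bool) → (ℕ → Bool)) × ℕ // DependsOnWindow j s.1}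
  have hstep : ∀ j (s : State j), ∃ s' : State (j + 1), s.1.2 < s'.1.2 ∧ j < s'.1.2 ∧
      (∀ k < s.1.2, ∀ l < s.1.2, ∀ b, s'.1.1 k b l = s.1.1 k b l) ∧
      (∀ x : ℕ → ℕ → Bool, box (fun k => s'.1.1 k (x k)) s'.1.2 ⊆ G j) ∧
      ∃ l < s'.1.2, ∀ k ≤ j, ∀ b, s'.1.1 k b l = b j := by
    intro j s
    obtain ⟨z', L', hz', h⟩ := exists_fusion_step (hG j) (hd j) s.2 s.1.2
    exact ⟨⟨(z', L'), hz'⟩, h⟩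
  choose next hlt hjlt hagree hbox hsplit using hstep
  let s : ∀ j, State j := fun j => Nat.rec ⟨(fun _ _ _ => false, 0), fun _ _ _ _ => rfl⟩ next j
  let z (j : ℕ) := (s j).1.1
  let L (j : ℕ) := (s j).1.2
  have hLmono : StrictMono L := strictMono_nat_of_lt_succ fun j => hlt j (s j)
  have hLge : ∀ j, j ≤ L j := fun _ => hLmono.le_apply
  have hz : ∀ i j, i ≤ j → ∀ k < L i, ∀ l < L i, ∀ b, z j k b l = z i k b l := by
    intro i j hij k hk l hl b
    induction j, hij using Nat.le_induction with
    | base => rfl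
    | succ j hj ih =>
      have : L i ≤ L j := hLmono.monotone hj
      exact (hagree j (s j) k (hk.trans_le this) l (hl.trans_le this) b).trans ih
  let φ : ℕ → (ℕ → Bool) → (ℕ → Bool) := fun k b l => z (max k l + 1) k b l
  have hφ : ∀ j, ∀ k < L j, ∀ l < L j, ∀ b, φ k b l = z j k b l := by
    intro j k hk l hl b
    have := hLge (max k l + 1)
    rcases le_total j (max k l + 1) with h | h
    · exact hz _ _ h k hk l hl b
    · exact (hz _ _ h k (by omega) l (by omega) b).symm
  refine ⟨φ, fun k => continuous_of_finite_dependence fun l => ⟨max k l + 1, fun b b' h => ?_⟩,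
    ?_, ?_⟩
  · exact congrFun ((s (max k l + 1)).2 k b b' fun i _ hi => h i hi) l
  · intro k b b' i hki hne heq
    obtain ⟨l, hl, hsp⟩ := hsplit i (s i)
    have hk : k < L (i + 1) := by have := hLge (i + 1); omega
    apply hne
    have h1 : φ k b l = b i := (hφ (i + 1) k hk l hl b).trans (hsp k hki b)
    have h2 : φ k b' l = b' i := (hφ (i + 1) k hk l hl b').trans (hsp k hki b')
    rw [← h1, ← h2, heq]
  · intro x j
    exact hbox j (s j) x fun k hk l hl => hφ (j + 1) k hk l hl (x k)

theorem exists_dense_open_isClopen_preimage {X Y ι : Type*} [TopologicalSpace X]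
    [TopologicalSpace Y] [Countable ι] {A : ι → Set X} (hA : ∀ i, HasBaireProperty (A i)) :
    ∃ G : ℕ → Set X, (∀ j, IsOpen (G j)) ∧ (∀ j, Dense (G j)) ∧
      ∀ g : Y → X, Continuous g → (∀ y j, g y ∈ G j) → ∀ i, IsClopen (g ⁻¹' A i) := by
  choose U m hU hm hAU using hA
  have hres : (⋂ i, ((m i)ᶜ ∩ (U i ∪ (closure (U i))ᶜ))) ∈ residual X := by
    refine countable_iInter_mem.2 fun i => inter_mem (hm i) ?_
    refine residual_of_dense_open ((hU i).union isClosed_closure.isOpen_compl) ?_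
    rw [dense_iff_closure_eq, closure_union, Set.eq_univ_iff_forall]
    intro x
    by_cases hx : x ∈ closure (U i)
    · exact Or.inl hx
    · exact Or.inr (subset_closure hx)
  obtain ⟨S, hSo, hSd, hSc, hS⟩ := mem_residual_iff.1 hres
  obtain ⟨G, hG⟩ := (hSc.insert Set.univ).exists_eq_range (Set.insert_nonempty _ _)
  have hGS : ∀ j, G j = Set.univ ∨ G j ∈ S := fun j =>
    (hG.symm ▸ Set.mem_range_self j : G j ∈ insert Set.univ S)
  refine ⟨G, fun j => ?_, fun j => ?_, fun g hg hgG i => ?_⟩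
  · rcases hGS j with h | h
    exacts [h ▸ isOpen_univ, hSo _ h]
  · rcases hGS j with h | h
    exacts [h ▸ dense_univ, hSd _ h]
  · have hmem : ∀ y, g y ∉ m i ∧ (g y ∈ U i ∨ g y ∉ closure (U i)) := by
      intro y
      refine Set.mem_iInter.1 (hS ?_) i
      intro t ht
      obtain ⟨j, rfl⟩ : t ∈ Set.range G := hG ▸ Set.mem_insert_of_mem _ ht
      exact hgG y j
    have h1 : g ⁻¹' A i = g ⁻¹' U i := by
      ext y
      have := (hmem y).1
      simp only [Set.mem_preimage, hAU i, Set.mem_symmDiff]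
      tauto
    have h2 : g ⁻¹' U i = g ⁻¹' closure (U i) := by
      ext y
      exact ⟨fun h => subset_closure h, fun h => (hmem y).2.resolve_right fun h' => h' h⟩
    rw [h1]
    exact ⟨h2 ▸ isClosed_closure.preimage hg, (hU i).preimage hg⟩

theorem map_substProd {A B : Type*} (g : A → B) (w : ℕ → FreeMonoid (Option A)) (a : ℕ → A)
    (i : ℕ) : FreeMonoid.map g (substProd w a i) =
      substProd (fun l => FreeMonoid.map (Option.map g) (w l)) (fun l => g (a l)) i := by
  induction i with
  | zero => rfl
  | succ i ih =>
    simp only [substProd, map_mul, ih, substLetter, FreeMonoid.map_map]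
    congr 3
    funext o
    cases o <;> rfl

theorem length_substProd_congr {A : Type*} (w : ℕ → FreeMonoid (Option A)) (a a' : ℕ → A)
    (i : ℕ) : (substProd w a i).length = (substProd w a' i).length := by
  induction i with
  | zero => rfl
  | succ i ih =>
    simp only [substProd, FreeMonoid.length_mul, ih]
    simp [substLetter, FreeMonoid.length]

theorem le_length_substProd {A : Type*} {w : ℕ → FreeMonoid (Option A)}
    (hw : ∀ i, none ∈ (w i).toList) (a : ℕ → A) (i : ℕ) : i ≤ (substProd w a i).length := by
  induction i with
  | zero => exact Nat.zero_le _
  | succ i ih =>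
    have : 0 < (substLetter (a i) (w i)).length := by
      simpa [substLetter, FreeMonoid.length] using List.length_pos_of_mem (hw i)
    simp only [substProd, FreeMonoid.length_mul]
    omega

/-- The infinite word with prefixes `substProd w b i`. -/
def limitWord (w : ℕ → FreeMonoid (Option Bool)) (b : ℕ → Bool) (l : ℕ) : Bool :=
  (substProd w b (l + 1)).toList.getD l false

theorem getD_substProd_of_le {w : ℕ → FreeMonoid (Option Bool)} {b : ℕ → Bool} {i i' l : ℕ}
    (hi : i ≤ i') (hl : l < (substProd w b i).length) :
    (substProd w b i').toList.getD l false = (substProd w b i).toList.getD l false := by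
  induction i', hi using Nat.le_induction with
  | base => rfl
  | succ n hn ih =>
    rw [← ih, substProd, FreeMonoid.toList_mul, List.getD_append]
    have hmono : (substProd w b i).length ≤ (substProd w b n).length := by
      refine Nat.le_induction le_rfl (fun r _ hr => hr.trans ?_) n hn
      simp [substProd, FreeMonoid.length_mul]
    exact hl.trans_le hmono

theorem limitWord_eq_getD {w : ℕ → FreeMonoid (Option Bool)} (hw : ∀ i, none ∈ (w i).toList)
    {b : ℕ → Bool} {i l : ℕ} (hl : l < (substProd w b i).length) :
    limitWord w b l = (substProd w b i).toList.getD l false := by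
  rcases le_total i (l + 1) with h | h
  · exact getD_substProd_of_le h hl
  · exact (getD_substProd_of_le h (le_length_substProd hw b (l + 1))).symm

theorem continuous_limitWord (w : ℕ → FreeMonoid (Option Bool)) : Continuous (limitWord w) :=
  continuous_of_finite_dependence fun l => ⟨l + 1, fun b b' h => by
    rw [limitWord, limitWord, substProd_congr (fun _ _ => rfl) h]⟩

theorem exists_limitWord_eq {w : ℕ → FreeMonoid (Option Bool)} (hw : ∀ i, none ∈ (w i).toList)
    (i : ℕ) : ∃ l, i ≤ l ∧ ∀ b, limitWord w b l = b i := by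
  obtain ⟨p, hp, hpn⟩ := List.getElem_of_mem (hw i)
  refine ⟨(substProd w (fun _ => false) i).length + p,
    (le_length_substProd hw _ i).trans (Nat.le_add_right _ _), fun b => ?_⟩
  rw [length_substProd_congr w _ b]
  have hp' : p < (substLetter (b i) (w i)).toList.length := by simpa [substLetter] using hp
  rw [limitWord_eq_getD hw (i := i + 1), substProd, FreeMonoid.toList_mul,
    List.getD_append_right _ _ _ ((substProd w b i).length + p) (Nat.le_add_right _ _)]
  · have : (substProd w b i).length + p - (substProd w b i).toList.length = p :=
      Nat.add_sub_cancel_left ..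
    rw [this, List.getD_eq_getElem _ _ hp']
    simp [substLetter, hpn]
  · rw [substProd, FreeMonoid.length_mul]
    exact Nat.add_lt_add_left hp' _

/-- Pointwise convergence of a subsequence of continuous functions on a product of perfect sets,
given coordinatewise by ranges of continuous separating maps. -/
theorem exists_subseq_tendsto_of_continuous {f : ℕ → (ℕ → ℕ → Bool) → (ℕ → Bool)}
    (hf : ∀ n, Continuous (f n)) :
    ∃ θ : ℕ → ℕ, StrictMono θ ∧ ∃ y : ℕ → (ℕ → Bool) → (ℕ → Bool),
      (∀ k, Continuous (y k)) ∧
      (∀ k b b' i, k ≤ i → b i ≠ b' i → ∃ l, k ≤ l ∧ y k b l ≠ y k b' l) ∧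
      ∀ b : ℕ → ℕ → Bool, ∃ z : ℕ → Bool,
        Tendsto (fun i => f (θ i) fun k => y k (b k)) atTop (nhds z) := by
  have hM : ∀ n, ∃ M, ∀ x y : ℕ → ℕ → Bool, (∀ k, ∀ l < M, x k l = y k l) →
      ∀ j ≤ n, f n x j = f n y j := by
    intro n
    obtain ⟨M, hM⟩ := exists_level_of_continuous
      (g := fun x (j : Fin (n + 1)) => f n x j) (by have := hf n; fun_prop)
    exact ⟨M, fun x y h j hj => congrFun (hM x y h) ⟨j, by omega⟩⟩
  choose M hM using hM
  let ν : ℕ → ℕ := fun m => Nat.findGreatest (fun n => M n ≤ m) m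
  have hν : Tendsto ν atTop atTop := by
    refine tendsto_atTop.2 fun n => ?_
    filter_upwards [eventually_ge_atTop n, eventually_ge_atTop (M n)] with m h1 h2
    exact Nat.le_findGreatest h1 h2
  have hMν : ∀ᶠ m in atTop, M (ν m) ≤ m := by
    filter_upwards [eventually_ge_atTop (M 0)] with m h
    exact Nat.findGreatest_spec (P := fun n => M n ≤ m) (Nat.zero_le m) h
  let pt : FreeMonoid (ℕ → Bool) → ℕ → ℕ → Bool := fun u k l =>
    (FreeMonoid.map (fun a : ℕ → Bool => a k) u).toList.getD l false
  let F : ℕ → Set (ℕ → Bool) := fun i => {a | ∀ k, i < k → a k = false}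
  have hF : ∀ i, (F i).Finite := by
    intro i
    refine (Set.finite_range fun (g : Fin (i + 1) → Bool) (k : ℕ) =>
      if h : k < i + 1 then g ⟨k, h⟩ else false).subset fun a ha => ⟨fun k => a k, ?_⟩
    funext k
    by_cases h : k < i + 1
    · simp [h]
    · simp [h, ha k (by omega)]
  obtain ⟨w, hw, hstable⟩ := exists_substProd_stable
    (fun j u => f (ν u.length) (pt u) j) F hF
  let v : ℕ → ℕ → FreeMonoid (Option Bool) := fun k i =>
    FreeMonoid.map (Option.map fun a : ℕ → Bool => a k) (w i)
  have hv : ∀ k i, none ∈ (v k i).toList := fun k i =>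
    List.mem_map.2 ⟨none, hw i, rfl⟩
  let mask : ℕ → (ℕ → Bool) → ℕ → Bool := fun k b i => if k ≤ i then b i else false
  let m : ℕ → ℕ := fun i => (substProd w (fun _ _ => false) i).length
  have hm : Tendsto m atTop atTop :=
    tendsto_atTop_mono (fun i => le_length_substProd hw _ i) tendsto_id
  obtain ⟨ψ, hψ, hθ⟩ := strictMono_subseq_of_tendsto_atTop (hν.comp hm)
  refine ⟨_, hθ, fun k b => limitWord (v k) (mask k b), fun k => ?_, ?_, fun b => ?_⟩
  · refine (continuous_limitWord (v k)).comp (continuous_pi fun i => ?_)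
    by_cases h : k ≤ i
    · simpa [mask, h] using continuous_apply i
    · simpa [mask, h] using continuous_const
  · intro k b b' i hki hne
    obtain ⟨l, hl, h⟩ := exists_limitWord_eq (hv k) i
    refine ⟨l, hki.trans hl, ?_⟩
    simpa [h, mask, hki] using hne
  · let a : ℕ → ℕ → Bool := fun i k => mask k (b k) i
    have ha : ∀ i, a i ∈ F i := fun i k hk => if_neg (by omega)
    choose z hz using fun j => hstable j a ha
    refine ⟨z, tendsto_pi_nhds.2 fun j => tendsto_const_nhds.congr' ?_⟩
    have hev : ∀ᶠ i in atTop, z j = f (ν (m i)) (fun k => limitWord (v k) (mask k (b k))) j := by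
      filter_upwards [eventually_gt_atTop j, hm.eventually hMν,
        (hν.comp hm).eventually_ge_atTop j] with i hi hMi hji
      rw [← hz j i hi, length_substProd_congr w a fun _ _ => false]
      refine hM _ _ _ (fun k l hl => ?_) j hji
      have hl' : l < (substProd (v k) (mask k (b k)) i).length := by
        have : (FreeMonoid.map (fun a : ℕ → Bool => a k) (substProd w a i)).length = m i := by
          rw [show m i = (substProd w a i).length from length_substProd_congr w _ _ i]
          simp [FreeMonoid.length]
        rw [map_substProd] at this
        exact (hl.trans_le hMi).trans_eq this.symm
      rw [limitWord_eq_getD (hv k) hl']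
      simp only [pt, map_substProd]
      rfl
    exact hψ.tendsto_atTop.eventually hev

theorem stmt12 (f : ℕ → (ℕ → (ℕ → Bool)) → (ℕ → Bool))
    (hf : ∀ n, ∀ U : Set (ℕ → Bool), IsOpen U → HasBaireProperty (f n ⁻¹' U)) :
    ∃ φ : ℕ → ℕ, StrictMono φ ∧
      ∃ P : ℕ → Set (ℕ → Bool),
        (∀ k, (P k).Nonempty ∧ Perfect (P k)) ∧
        ∀ x ∈ Set.pi Set.univ P, ∃ y : ℕ → Bool,
          Tendsto (fun i => f (φ i) x) atTop (nhds y) := by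
  obtain ⟨G, hGo, hGd, hG⟩ := exists_dense_open_isClopen_preimage (Y := ℕ → ℕ → Bool)
    (A := fun p : ℕ × ℕ => f p.1 ⁻¹' ((fun y => y p.2) ⁻¹' {true}))
    fun p => hf p.1 _ ((isOpen_discrete _).preimage (by fun_prop))
  obtain ⟨φ, hφc, hφs, hφG⟩ := exists_continuous_maps_into_dense_open hGo hGd
  have hφ : Continuous fun (x : ℕ → ℕ → Bool) k => φ k (x k) :=
    continuous_pi fun k => (hφc k).comp (continuous_apply k)
  have hcont : ∀ n, Continuous fun x : ℕ → ℕ → Bool => f n fun k => φ k (x k) := fun n =>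
    continuous_pi fun j => (continuous_bool_rng true).2 (hG _ hφ hφG (n, j))
  obtain ⟨θ, hθ, y, hyc, hys, hy⟩ := exists_subseq_tendsto_of_continuous hcont
  refine ⟨θ, hθ, fun k => Set.range fun b => φ k (y k b), fun k => ⟨Set.range_nonempty _, ?_⟩,
    fun x hx => ?_⟩
  · refine perfect_range_of_separates ((hφc k).comp (hyc k)) k fun b b' i hki hne => ?_
    obtain ⟨l, hl, hne'⟩ := hys k b b' i hki hne
    exact hφs k _ _ l hl hne'
  · choose b hb using fun k => hx k (Set.mem_univ k)
    obtain rfl : (fun k => φ k (y k (b k))) = x := funext hb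
    exact hy b
end
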